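/- Let 0 < p, q < ∞ and let f be a continuous function on the unit circle 𝕋 such that f(U) − f(V) ∈ S_q whenever U and V are unitary operators with U − V ∈ S_p. Then Ω_{f,p,q}(δ) < ∞ for all δ > 0, the limits lim_{δ→0+} Ω_{f,p,q}(δ)/δ^{p/q} and lim_{δ→∞} Ω_{f,p,q}(δ)/δ^{p/q} exist in [0, ∞], and lim_{δ→0+} Ω_{f,p,q}(δ)/δ^{p/q} = inf_{δ>0} Ω_{f,p,q}(δ)/δ^{p/q} ≤ sup_{δ>0} Ω_{f,p,q}(δ)/δ^{p/q} = lim_{δ→∞} Ω_{f,p,q}(δ)/δ^{p/q}. In particular, if f is nonconstant, then there exist positive numbers c₁ and c₂ such that Ω_{f,p,q}(δ) ≤ c₁·δ^{p/q} for every δ ∈ (0, 1] and Ω_{f,p,q}(δ) ≥ c₂·δ^{p/q} for every δ ∈ [1, ∞). -/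

import Mathlib

open scoped BigOperators
noncomputable section

/-- The `j`-th singular value of a bounded operator `T` on a Hilbert space:
`s_j(T) = inf {‖T - R‖ : rank R ≤ j}`. -/
def sVal {H : Type} [NormedAddCommGroup H] [InnerProductSpace ℂ H] [CompleteSpace H]
    (T : H →L[ℂ] H) (j : ℕ) : ℝ :=
  sInf {c : ℝ | ∃ R : H →L[ℂ] H, LinearMap.rank (R : H →ₗ[ℂ] H) ≤ (j : Cardinal) ∧ c = ‖T - R‖}

/-- Membership in the Schatten–von Neumann class `S_p`. -/
def MemSchatten {H : Type} [NormedAddCommGroup H] [InnerProductSpace ℂ H] [CompleteSpace H]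
    (p : ℝ) (T : H →L[ℂ] H) : Prop :=
  Summable fun j : ℕ => sVal T j ^ p

/-- The Schatten–von Neumann norm `‖T‖_{S_p} = (∑_{j ≥ 0} s_j(T)^p)^{1/p}`. -/
def schNorm {H : Type} [NormedAddCommGroup H] [InnerProductSpace ℂ H] [CompleteSpace H]
    (p : ℝ) (T : H →L[ℂ] H) : ℝ :=
  (∑' j : ℕ, sVal T j ^ p) ^ (1 / p)

/-- The `[0, ∞]`-valued Schatten norm `‖T‖_{S_q} = (∑_{j ≥ 0} s_j(T)^q)^{1/q}`; it is finite
exactly when `T ∈ S_q`. -/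
def schNormE {H : Type} [NormedAddCommGroup H] [InnerProductSpace ℂ H] [CompleteSpace H]
    (q : ℝ) (T : H →L[ℂ] H) : ENNReal :=
  (∑' j : ℕ, ENNReal.ofReal (sVal T j ^ q)) ^ (1 / q)

/-- A pair of unitary operators `U, V` on a separable Hilbert space with `‖U - V‖_{S_p} ≤ δ`. -/
structure UnitaryPair (p δ : ℝ) where
  H : Type
  [i₁ : NormedAddCommGroup H]
  [i₂ : InnerProductSpace ℂ H]
  [i₃ : CompleteSpace H]
  [i₄ : TopologicalSpace.SeparableSpace H]
  U : H →L[ℂ] H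
  V : H →L[ℂ] H
  hU : U ∈ unitary (H →L[ℂ] H)
  hV : V ∈ unitary (H →L[ℂ] H)
  hδ : schNormE p (U - V) ≤ ENNReal.ofReal δ

/-- The value `‖f(U) - f(V)‖_{S_q}` for such a pair. -/
def UnitaryPair.val {p δ : ℝ} (P : UnitaryPair p δ) (f : ℂ → ℂ) (q : ℝ) : ENNReal :=
  letI := P.i₁; letI := P.i₂; letI := P.i₃
  schNormE q (cfc f P.U - cfc f P.V)

/-- `Ω_{f,p,q}(δ) = sup {‖f(U) - f(V)‖_{S_q} : U, V unitaries on a separable Hilbert space with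
`‖U - V‖_{S_p} ≤ δ}`, valued in `[0, ∞]`. -/
def Omega (f : ℂ → ℂ) (p q δ : ℝ) : ENNReal :=
  ⨆ P : UnitaryPair p δ, P.val f q

set_option linter.unusedSectionVars false

section SingularValues

variable {H : Type} [NormedAddCommGroup H] [InnerProductSpace ℂ H] [CompleteSpace H]

lemma sVal_le (T R : H →L[ℂ] H) {j : ℕ}
    (hR : LinearMap.rank (R : H →ₗ[ℂ] H) ≤ (j : Cardinal)) : sVal T j ≤ ‖T - R‖ :=
  csInf_le ⟨0, by rintro _ ⟨R, -, rfl⟩; exact norm_nonneg _⟩ ⟨R, hR, rfl⟩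

lemma le_sVal {T : H →L[ℂ] H} {j : ℕ} {c : ℝ}
    (h : ∀ R : H →L[ℂ] H, LinearMap.rank (R : H →ₗ[ℂ] H) ≤ (j : Cardinal) → c ≤ ‖T - R‖) :
    c ≤ sVal T j :=
  le_csInf ⟨_, 0, by simp, rfl⟩ (by rintro _ ⟨R, hR, rfl⟩; exact h R hR)

lemma sVal_nonneg (T : H →L[ℂ] H) (j : ℕ) : 0 ≤ sVal T j :=
  le_sVal fun _ _ => norm_nonneg _

lemma exists_rank_le_of_sVal_lt {T : H →L[ℂ] H} {j : ℕ} {c : ℝ} (h : sVal T j < c) :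
    ∃ R : H →L[ℂ] H, LinearMap.rank (R : H →ₗ[ℂ] H) ≤ (j : Cardinal) ∧ ‖T - R‖ < c := by
  contrapose! h
  exact le_sVal h

lemma sVal_antitone (T : H →L[ℂ] H) : Antitone (sVal T) := fun _ _ hij =>
  le_sVal fun R hR => sVal_le T R (hR.trans (by exact_mod_cast hij))

lemma sVal_zero_eq_norm (T : H →L[ℂ] H) : sVal T 0 = ‖T‖ := by
  apply le_antisymm
  · simpa using sVal_le T 0 (j := 0) (by simp)
  · refine le_sVal fun R hR => ?_
    have hR0 : R = 0 := by
      have h0 : Module.rank ℂ (LinearMap.range (R : H →ₗ[ℂ] H)) = 0 := by simpa using hR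
      rw [Submodule.rank_eq_zero, LinearMap.range_eq_bot] at h0
      exact ContinuousLinearMap.coe_injective h0
    simp [hR0]

lemma sVal_mul_le (A T : H →L[ℂ] H) (j : ℕ) : sVal (A * T) j ≤ ‖A‖ * sVal T j := by
  rcases (norm_nonneg A).eq_or_lt with hA | hA
  · rw [← hA, zero_mul]
    have : A = 0 := norm_eq_zero.mp hA.symm
    simpa [this] using sVal_le (A * T) 0 (j := j) (by simp)
  · rw [← div_le_iff₀' hA]
    refine le_sVal fun R hR => ?_
    rw [div_le_iff₀' hA]
    calc sVal (A * T) j ≤ ‖A * T - A * R‖ :=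
          sVal_le _ _ ((LinearMap.rank_comp_le_right (R : H →ₗ[ℂ] H) (A : H →ₗ[ℂ] H)).trans hR)
      _ = ‖A * (T - R)‖ := by rw [mul_sub]
      _ ≤ ‖A‖ * ‖T - R‖ := norm_mul_le _ _

lemma sVal_mul_le' (T A : H →L[ℂ] H) (j : ℕ) : sVal (T * A) j ≤ sVal T j * ‖A‖ := by
  rcases (norm_nonneg A).eq_or_lt with hA | hA
  · rw [← hA, mul_zero]
    have : A = 0 := norm_eq_zero.mp hA.symm
    simpa [this] using sVal_le (T * A) 0 (j := j) (by simp)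
  · rw [← div_le_iff₀ hA]
    refine le_sVal fun R hR => ?_
    rw [div_le_iff₀ hA]
    calc sVal (T * A) j ≤ ‖T * A - R * A‖ :=
          sVal_le _ _ ((LinearMap.rank_comp_le_left (A : H →ₗ[ℂ] H) (R : H →ₗ[ℂ] H)).trans hR)
      _ = ‖(T - R) * A‖ := by rw [sub_mul]
      _ ≤ ‖T - R‖ * ‖A‖ := norm_mul_le _ _

lemma sVal_add_le (S T : H →L[ℂ] H) (i j : ℕ) :
    sVal (S + T) (i + j) ≤ sVal S i + sVal T j := by
  rw [← sub_le_iff_le_add]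
  refine le_sVal fun R hR => ?_
  rw [sub_le_comm]
  refine le_sVal fun R' hR' => ?_
  rw [sub_le_iff_le_add']
  calc sVal (S + T) (i + j) ≤ ‖S + T - (R + R')‖ := by
        refine sVal_le _ _ ((LinearMap.rank_add_le (R : H →ₗ[ℂ] H) (R' : H →ₗ[ℂ] H)).trans ?_)
        push_cast
        exact add_le_add hR hR'
    _ = ‖(S - R) + (T - R')‖ := by congr 1; abel
    _ ≤ ‖S - R‖ + ‖T - R'‖ := norm_add_le _ _

/-- The easy half of the max-min principle: an operator bounded below by `c` on a subspace of
dimension at least `j + 1` has `j`-th singular value at least `c`. -/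
lemma le_sVal_of_submodule {T : H →L[ℂ] H} {j : ℕ} {c : ℝ} (E : Submodule ℂ H)
    (hE : ((j + 1 : ℕ) : Cardinal) ≤ Module.rank ℂ E) (h : ∀ x ∈ E, c * ‖x‖ ≤ ‖T x‖) :
    c ≤ sVal T j := by
  refine le_sVal fun R hR => ?_
  have hinj : ¬ Function.Injective ((R : H →ₗ[ℂ] H) ∘ₗ E.subtype) := by
    intro hinj
    have h1 : Module.rank ℂ E ≤ LinearMap.rank (R : H →ₗ[ℂ] H) := by
      rw [← rank_range_of_injective _ hinj]
      exact LinearMap.rank_comp_le_left _ _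
    have h2 : ((j + 1 : ℕ) : Cardinal) ≤ (j : Cardinal) := hE.trans (h1.trans hR)
    have h3 : j + 1 ≤ j := by exact_mod_cast h2
    omega
  rw [← LinearMap.ker_eq_bot, Submodule.eq_bot_iff] at hinj
  push Not at hinj
  obtain ⟨x, hx, hx0⟩ := hinj
  have hRx : R x = 0 := by simpa using hx
  have hxpos : 0 < ‖(x : H)‖ := by simpa using hx0
  have h1 : c * ‖(x : H)‖ ≤ ‖T - R‖ * ‖(x : H)‖ :=
    (h x x.2).trans (by simpa [hRx] using (T - R).le_opNorm (x : H))
  exact le_of_mul_le_mul_right h1 hxpos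

lemma cfc_mul_mul_self (A : H →L[ℂ] H) {φ ψ : ℝ → ℝ}
    (hφ : Continuous φ) (hψ : Continuous ψ) :
    cfc (fun t => φ t * ψ t * φ t) A = cfc φ A * cfc ψ A * cfc φ A := by
  rw [cfc_mul (fun t => φ t * ψ t) φ A (hφ.mul hψ).continuousOn hφ.continuousOn,
    cfc_mul φ ψ A hφ.continuousOn hψ.continuousOn]

lemma norm_mul_cfc_star_mul_self_le (T : H →L[ℂ] H) {φ : ℝ → ℝ} (hφ : Continuous φ) {c : ℝ}
    (hc : 0 ≤ c) (h : ∀ t, 0 ≤ t → |φ t * t * φ t| ≤ c * c) :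
    ‖T * cfc φ (star T * T)‖ ≤ c := by
  have hsa : star (cfc φ (star T * T)) = cfc φ (star T * T) :=
    (cfc_predicate φ (star T * T) : IsSelfAdjoint _)
  have h1 : star (T * cfc φ (star T * T)) * (T * cfc φ (star T * T))
      = cfc (fun t => φ t * t * φ t) (star T * T) := by
    rw [cfc_mul_mul_self _ hφ continuous_id', cfc_id' ℝ (star T * T)
      (.star_mul_self T), star_mul, hsa]
    simp only [mul_assoc]
  refine (mul_self_le_mul_self_iff (norm_nonneg _) hc).mpr ?_
  rw [← CStarRing.norm_star_mul_self, h1]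
  exact norm_cfc_le (by positivity) fun t ht =>
    h t (spectrum_nonneg_of_nonneg (star_mul_self_nonneg T) ht)

open ContinuousLinearMap in
lemma mul_norm_cfc_apply_le (T : H →L[ℂ] H) {φ : ℝ → ℝ} (hφ : Continuous φ) (c : ℝ)
    (h : ∀ t, 0 ≤ t → 0 ≤ φ t * (t - c ^ 2) * φ t) (y : H) :
    c * ‖cfc φ (star T * T) y‖ ≤ ‖T (cfc φ (star T * T) y)‖ := by
  have hsa : star (cfc φ (star T * T)) = cfc φ (star T * T) :=
    (cfc_predicate φ (star T * T) : IsSelfAdjoint _)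
  have hpos : 0 ≤ cfc (fun t => φ t * (t - c ^ 2) * φ t) (star T * T) :=
    cfc_nonneg fun t ht => h t (spectrum_nonneg_of_nonneg (star_mul_self_nonneg T) ht)
  rw [cfc_mul_mul_self _ hφ (ψ := fun t => t - c ^ 2) (by fun_prop),
    cfc_sub (fun t => t) (fun _ => c ^ 2) (star T * T) continuousOn_id continuousOn_const,
    cfc_id' ℝ (star T * T) (.star_mul_self T), cfc_const (c ^ 2) (star T * T) (.star_mul_self T),
    Algebra.algebraMap_eq_smul_one] at hpos
  generalize cfc φ (star T * T) = B at *
  have h1 := ((nonneg_iff_isPositive _).mp hpos).re_inner_nonneg_left y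
  have hBadj : ∀ u v, inner ℂ (B u) v = inner ℂ u (B v) := fun u v => by
    conv_lhs => rw [← hsa, star_eq_adjoint, adjoint_inner_left]
  have h3 : inner ℂ (star T (T (B y))) (B y) = inner ℂ (T (B y)) (T (B y)) := by
    rw [star_eq_adjoint, adjoint_inner_left]
  change 0 ≤ RCLike.re (inner ℂ (B (star T (T (B y)) - (c ^ 2 : ℝ) • B y)) y) at h1
  rw [hBadj, inner_sub_left, h3, map_sub, inner_self_eq_norm_sq,
    RCLike.real_smul_eq_coe_smul (K := ℂ), inner_smul_left, RCLike.conj_ofReal,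
    RCLike.re_ofReal_mul, inner_self_eq_norm_sq, sub_nonneg, ← mul_pow] at h1
  exact le_of_sq_le_sq h1 (norm_nonneg _)

lemma exists_continuous_cutoff {c : ℝ} (hc : 0 < c) :
    ∃ φ : ℝ → ℝ, Continuous φ ∧ (∀ t, 0 ≤ t → |φ t * t * φ t| ≤ c * c) ∧
      ∀ t, 0 ≤ t → 0 ≤ (1 - φ t) * (t - c ^ 2) * (1 - φ t) := by
  have hmax : ∀ t, 0 < max (Real.sqrt t) c := fun t => lt_max_of_lt_right hc
  refine ⟨fun t => c / max (Real.sqrt t) c,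
    continuous_const.div (Real.continuous_sqrt.max continuous_const) fun t => (hmax t).ne',
    fun t ht => ?_, fun t ht => ?_⟩
  · have h1 : Real.sqrt t / max (Real.sqrt t) c ≤ 1 :=
      (div_le_one (hmax t)).mpr (le_max_left _ _)
    have h2 : 0 ≤ Real.sqrt t / max (Real.sqrt t) c :=
      div_nonneg (Real.sqrt_nonneg t) (hmax t).le
    have h3 : c / max (Real.sqrt t) c * t * (c / max (Real.sqrt t) c)
        = c * c * ((Real.sqrt t / max (Real.sqrt t) c) *
          (Real.sqrt t / max (Real.sqrt t) c)) := by
      rw [div_mul_div_comm (Real.sqrt t), Real.mul_self_sqrt ht]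
      ring
    rw [h3, abs_of_nonneg (by positivity)]
    exact mul_le_of_le_one_right (by positivity) (mul_le_one₀ h1 h2 h1)
  · rcases le_total (Real.sqrt t) c with htc | htc
    · simp [max_eq_right htc, hc.ne']
    · have : 0 ≤ t - c ^ 2 := sub_nonneg.mpr ((Real.le_sqrt' hc).mp htc)
      rw [mul_right_comm]
      exact mul_nonneg (mul_self_nonneg _) this

/-- The spectral half of the max-min principle: if the `j`-th singular value exceeds `c`, then
the operator is bounded below by `c` on some subspace of dimension at least `j + 1`. -/
lemma exists_submodule_of_lt_sVal {T : H →L[ℂ] H} {j : ℕ} {c : ℝ} (hc : 0 < c)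
    (h : c < sVal T j) :
    ∃ E : Submodule ℂ H, ((j + 1 : ℕ) : Cardinal) ≤ Module.rank ℂ E ∧
      ∀ x ∈ E, c * ‖x‖ ≤ ‖T x‖ := by
  obtain ⟨φ, hφ, hsmall, hlarge⟩ := exists_continuous_cutoff hc
  set B : H →L[ℂ] H := cfc (fun t => 1 - φ t) (star T * T) with hB
  refine ⟨LinearMap.range (B : H →ₗ[ℂ] H), ?_, ?_⟩
  · by_contra! hlt
    have hrank : LinearMap.rank (B : H →ₗ[ℂ] H) ≤ (j : Cardinal) := by
      rw [Nat.cast_succ, ← Cardinal.succ_natCast] at hlt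
      exact Order.lt_succ_iff.mp hlt
    have h1 : sVal T j ≤ ‖T - T * B‖ :=
      sVal_le _ _ ((LinearMap.rank_comp_le_right (B : H →ₗ[ℂ] H) (T : H →ₗ[ℂ] H)).trans hrank)
    have h2 : T - T * B = T * cfc φ (star T * T) := by
      rw [hB, cfc_sub (fun _ => 1) φ _ continuousOn_const hφ.continuousOn,
        cfc_const_one ℝ (star T * T) (.star_mul_self T), mul_sub, mul_one, sub_sub_cancel]
    rw [h2] at h1
    exact (h.trans_le h1).not_ge (norm_mul_cfc_star_mul_self_le T hφ hc.le hsmall)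
  · rintro _ ⟨y, rfl⟩
    exact mul_norm_cfc_apply_le T (continuous_const.sub hφ) c hlarge y

end SingularValues

section SchattenSum

open MeasureTheory
open scoped ENNReal

variable {H : Type} [NormedAddCommGroup H] [InnerProductSpace ℂ H] [CompleteSpace H]

/-- The number of singular values of `T` that exceed `c`. -/
def sValCount (T : H →L[ℂ] H) (c : ℝ) : ℝ≥0∞ :=
  ∑' j : ℕ, if c < sVal T j then 1 else 0

/-- The sum of the `p`-th powers of the singular values of `T`. -/
def schSum (p : ℝ) (T : H →L[ℂ] H) : ℝ≥0∞ :=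
  ∑' j : ℕ, ENNReal.ofReal (sVal T j ^ p)

lemma schNormE_eq (p : ℝ) (T : H →L[ℂ] H) : schNormE p T = schSum p T ^ (1 / p) := rfl

lemma schNormE_rpow {p : ℝ} (hp : 0 < p) (T : H →L[ℂ] H) : schNormE p T ^ p = schSum p T := by
  rw [schNormE_eq, ← ENNReal.rpow_mul, one_div_mul_cancel hp.ne', ENNReal.rpow_one]

lemma memSchatten_iff {p : ℝ} (T : H →L[ℂ] H) : MemSchatten p T ↔ schSum p T ≠ ⊤ := by
  have hnn : ∀ j, 0 ≤ sVal T j ^ p := fun j => Real.rpow_nonneg (sVal_nonneg T j) p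
  refine ⟨fun h => h.tsum_ofReal_ne_top, fun h => ?_⟩
  simpa [MemSchatten, ENNReal.toReal_ofReal (hnn _)] using ENNReal.summable_toReal h

lemma natCast_le_sValCount {T : H →L[ℂ] H} {c : ℝ} {j : ℕ} (h : c < sVal T j) :
    ((j + 1 : ℕ) : ℝ≥0∞) ≤ sValCount T c := by
  calc ((j + 1 : ℕ) : ℝ≥0∞) = ∑ i ∈ Finset.range (j + 1), if c < sVal T i then 1 else 0 := by
        rw [Finset.sum_congr rfl (g := fun _ => (1 : ℝ≥0∞))]
        · simp
        · intro i hi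
          rw [if_pos]
          exact h.trans_le (sVal_antitone T (Nat.lt_succ_iff.mp (Finset.mem_range.mp hi)))
    _ ≤ _ := ENNReal.sum_le_tsum _

lemma sValCount_le {T : H →L[ℂ] H} {c : ℝ} {j : ℕ} (h : sVal T j ≤ c) :
    sValCount T c ≤ j := by
  have h0 : ∀ i ∉ Finset.range j, (if c < sVal T i then (1 : ℝ≥0∞) else 0) = 0 := fun i hi => by
    rw [if_neg]
    rw [Finset.mem_range, not_lt] at hi
    exact ((sVal_antitone T hi).trans h).not_gt
  rw [sValCount, tsum_eq_sum h0]
  calc _ ≤ ∑ i ∈ Finset.range j, (1 : ℝ≥0∞) :=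
        Finset.sum_le_sum fun i _ => by split_ifs <;> simp
    _ = j := by simp

/-- Layer-cake formula for `∑ s_j(T) ^ p`. -/
lemma schSum_eq_lintegral {p : ℝ} (hp : 0 < p) (T : H →L[ℂ] H) :
    schSum p T = ∫⁻ t in Set.Ioi (0 : ℝ), sValCount T (t ^ (1 / p)) := by
  have h1 : ∀ j, ENNReal.ofReal (sVal T j ^ p)
      = ∫⁻ t in Set.Ioi (0 : ℝ), if t ^ (1 / p) < sVal T j then 1 else 0 := fun j => by
    have h2 : ∀ t ∈ Set.Ioi (0 : ℝ), (if t ^ (1 / p) < sVal T j then (1 : ℝ≥0∞) else 0)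
        = (Set.Iio (sVal T j ^ p)).indicator 1 t := fun t ht => by
      have : t ^ (1 / p) < sVal T j ↔ t < sVal T j ^ p := by
        rw [one_div, Real.rpow_inv_lt_iff_of_pos (le_of_lt ht) (sVal_nonneg T j) hp]
      simp only [this, Set.indicator, Set.mem_Iio, Pi.one_apply]
    rw [setLIntegral_congr_fun measurableSet_Ioi h2, lintegral_indicator_one measurableSet_Iio,
      Measure.restrict_apply measurableSet_Iio, Set.inter_comm, Set.Ioi_inter_Iio, Real.volume_Ioo,
      sub_zero]
  rw [schSum, tsum_congr h1, ← lintegral_tsum]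
  · rfl
  · intro j
    refine (Measurable.ite ?_ measurable_const measurable_const).aemeasurable
    exact measurableSet_lt (by fun_prop) measurable_const

lemma measurable_sValCount (p : ℝ) (T : H →L[ℂ] H) :
    Measurable fun t : ℝ => sValCount T (t ^ (1 / p)) :=
  Measurable.tsum fun _ =>
    Measurable.ite (measurableSet_lt (by fun_prop) measurable_const)
      measurable_const measurable_const

end SchattenSum

section DirectSum

open MeasureTheory
open scoped ENNReal

variable {ι : Type} {G : ι → Type} [∀ i, NormedAddCommGroup (G i)]
  [∀ i, InnerProductSpace ℂ (G i)] [∀ i, CompleteSpace (G i)]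
  {T : lp G 2 →L[ℂ] lp G 2} {D : ∀ i, G i →L[ℂ] G i}

lemma norm_le_of_diagonal (hT : ∀ x i, T x i = D i (x i)) {K : ℝ} (hK : 0 ≤ K)
    (hD : ∀ i, ‖D i‖ ≤ K) : ‖T‖ ≤ K := by
  have : T = lp.mapCLM 2 D hK hD := by
    ext x i
    rw [hT]
    rfl
  rw [this]
  exact lp.norm_mapCLM_le 2 D hK hD

open Classical in
/-- The diagonal operator on a Hilbert sum with finitely many nonzero entries. -/
def finsetDiagonal (s : Finset ι) (D : ∀ i, G i →L[ℂ] G i) : lp G 2 →L[ℂ] lp G 2 :=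
  ∑ i ∈ s, lp.singleContinuousLinearMap ℂ G 2 i ∘L D i ∘L lp.evalCLM ℂ G 2 i

lemma finsetDiagonal_apply (s : Finset ι) (hD : ∀ i ∉ s, D i = 0) (x : lp G 2) (i : ι) :
    finsetDiagonal s D x i = D i (x i) := by
  classical
  rw [finsetDiagonal, sum_apply, lp.coeFn_sum, Finset.sum_apply]
  have h1 : ∀ k ∈ s, (((lp.singleContinuousLinearMap ℂ G 2 k ∘L D k ∘L lp.evalCLM ℂ G 2 k) x :
      lp G 2) : ∀ i, G i) i = if k = i then D i (x i) else 0 := fun k _ => by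
    change (lp.single 2 k (D k (x k)) : lp G 2) i = _
    split_ifs with hki
    · subst hki
      exact lp.single_apply_self 2 k _
    · exact lp.single_apply_ne 2 k _ (Ne.symm hki)
  rw [Finset.sum_congr rfl h1, Finset.sum_ite_eq']
  split_ifs with h
  · rfl
  · simp [hD i h]

lemma rank_finsetDiagonal_le (s : Finset ι) (D : ∀ i, G i →L[ℂ] G i) (m : ι → ℕ)
    (hm : ∀ i ∈ s, LinearMap.rank (D i : G i →ₗ[ℂ] G i) ≤ m i) :
    LinearMap.rank (finsetDiagonal s D : lp G 2 →ₗ[ℂ] lp G 2) ≤ ((∑ i ∈ s, m i : ℕ) : Cardinal) := by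
  classical
  have h1 : (finsetDiagonal s D : lp G 2 →ₗ[ℂ] lp G 2) = ∑ i ∈ s,
      ((lp.singleContinuousLinearMap ℂ G 2 i ∘L D i ∘L lp.evalCLM ℂ G 2 i : lp G 2 →L[ℂ] lp G 2) :
        lp G 2 →ₗ[ℂ] lp G 2) := by
    ext x : 1
    simp [finsetDiagonal, LinearMap.sum_apply]
  rw [h1]
  refine (LinearMap.rank_finsetSum_le s _).trans ?_
  push_cast
  refine Finset.sum_le_sum fun i hi => le_trans ?_ (hm i hi)
  exact (LinearMap.rank_comp_le_right _ (lp.singleContinuousLinearMap ℂ G 2 i : G i →ₗ[ℂ] lp G 2)).trans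
    (LinearMap.rank_comp_le_left (lp.evalCLM ℂ G 2 i : lp G 2 →ₗ[ℂ] G i) (D i : G i →ₗ[ℂ] G i))

lemma sValCount_diagonal_le (hT : ∀ x i, T x i = D i (x i)) {c : ℝ} (hc : 0 ≤ c) :
    sValCount T c ≤ ∑' i, sValCount (D i) c := by
  by_cases htop : ∑' i, sValCount (D i) c = ⊤
  · simp [htop]
  have hm : ∀ i, ∃ m : ℕ, sVal (D i) m ≤ c ∧ (m : ℝ≥0∞) ≤ sValCount (D i) c := fun i => by
    have hne : sValCount (D i) c ≠ ⊤ := ENNReal.ne_top_of_tsum_ne_top htop i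
    have hex : ∃ m, sVal (D i) m ≤ c := by
      by_contra! hlt
      obtain ⟨n, hn⟩ := ENNReal.exists_nat_gt hne
      have h1 := natCast_le_sValCount (hlt n)
      have h2 : ((n : ℕ) : ℝ≥0∞) ≤ ((n + 1 : ℕ) : ℝ≥0∞) := by exact_mod_cast n.le_succ
      exact (hn.trans_le (h2.trans h1)).false
    classical
    refine ⟨Nat.find hex, Nat.find_spec hex, ?_⟩
    rcases hk : Nat.find hex with _ | k
    · simp
    · exact natCast_le_sValCount (not_le.mp (Nat.find_min hex (by omega)))
  choose m hmc hmle using hm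
  have hmsum : ∑' i, (m i : ℝ≥0∞) ≠ ⊤ := ne_top_of_le_ne_top htop (ENNReal.tsum_le_tsum hmle)
  have hfin : {i | m i ≠ 0}.Finite := by
    refine (ENNReal.finite_const_le_of_tsum_ne_top hmsum one_ne_zero).subset fun i hi => ?_
    have : 1 ≤ m i := Nat.one_le_iff_ne_zero.mpr hi
    simpa using! this
  set s := hfin.toFinset with hs
  have hs0 : ∀ i ∉ s, m i = 0 := fun i hi => by simpa [hs] using hi
  have key : sVal T (∑ i ∈ s, m i) ≤ c := by
    refine le_of_forall_pos_lt_add fun ε hε => ?_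
    have hR : ∀ i, ∃ R : G i →L[ℂ] G i, LinearMap.rank (R : G i →ₗ[ℂ] G i) ≤ (m i : Cardinal) ∧
        ‖D i - R‖ < c + ε / 2 := fun i =>
      exists_rank_le_of_sVal_lt ((hmc i).trans_lt (by linarith))
    choose R hRrank hRnorm using hR
    have hR0 : ∀ i ∉ s, R i = 0 := fun i hi => by
      have h0 : Module.rank ℂ (LinearMap.range (R i : G i →ₗ[ℂ] G i)) = 0 := by
        simpa [hs0 i hi] using hRrank i
      rw [Submodule.rank_eq_zero, LinearMap.range_eq_bot] at h0
      exact ContinuousLinearMap.coe_injective h0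
    have h1 := sVal_le T (finsetDiagonal s R) (rank_finsetDiagonal_le s R m fun i _ => hRrank i)
    have h2 : ‖T - finsetDiagonal s R‖ ≤ c + ε / 2 := by
      refine norm_le_of_diagonal (D := fun i => D i - R i) (fun x i => ?_) (by linarith)
        fun i => (hRnorm i).le
      rw [sub_apply, sub_apply, lp.coeFn_sub, Pi.sub_apply,
        hT, finsetDiagonal_apply s hR0]
    linarith
  calc sValCount T c ≤ ((∑ i ∈ s, m i : ℕ) : ℝ≥0∞) := sValCount_le key
    _ = ∑ i ∈ s, (m i : ℝ≥0∞) := by push_cast; rfl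
    _ ≤ ∑ i ∈ s, sValCount (D i) c := Finset.sum_le_sum fun i _ => hmle i
    _ ≤ _ := ENNReal.sum_le_tsum _

lemma mul_norm_le_of_diagonal (hT : ∀ x i, T x i = D i (x i)) {c : ℝ} (hc : 0 ≤ c) {x : lp G 2}
    (h : ∀ i, c * ‖x i‖ ≤ ‖D i (x i)‖) : c * ‖x‖ ≤ ‖T x‖ := by
  have h2 : (0 : ℝ) < (2 : ℝ≥0∞).toReal := by norm_num
  rw [← abs_of_nonneg hc, ← Real.norm_eq_abs, ← Complex.norm_real, ← norm_smul]
  refine (lp.norm_mono (by norm_num) fun i => ?_)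
  rw [hT, lp.coeFn_smul, Pi.smul_apply, norm_smul, Complex.norm_real, Real.norm_eq_abs,
    abs_of_nonneg hc]
  exact h i

open Classical in
/-- The embedding of a finite family of subspaces of the summands into the Hilbert sum. -/
def finsetEmbed (s : Finset ι) (E : ∀ i, Submodule ℂ (G i)) : (∀ i : s, E i) →ₗ[ℂ] lp G 2 :=
  ∑ i : s, (lp.lsingle (𝕜 := ℂ) (E := G) 2 (i : ι)) ∘ₗ (E i).subtype ∘ₗ LinearMap.proj i

lemma finsetEmbed_apply (s : Finset ι) (E : ∀ i, Submodule ℂ (G i)) (y : ∀ i : s, E i) (i : s) :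
    finsetEmbed s E y i = y i := by
  classical
  rw [finsetEmbed, LinearMap.sum_apply, lp.coeFn_sum, Finset.sum_apply, Finset.sum_eq_single i]
  · exact lp.single_apply_self 2 (i : ι) _
  · intro k _ hk
    exact lp.single_apply_ne 2 (k : ι) _ fun h => hk (Subtype.ext h.symm)
  · simp

lemma finsetEmbed_apply_of_notMem (s : Finset ι) (E : ∀ i, Submodule ℂ (G i))
    (y : ∀ i : s, E i) {i : ι} (hi : i ∉ s) : finsetEmbed s E y i = 0 := by
  classical
  rw [finsetEmbed, LinearMap.sum_apply, lp.coeFn_sum, Finset.sum_apply]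
  refine Finset.sum_eq_zero fun k _ => ?_
  exact lp.single_apply_ne 2 (k : ι) _ fun h => hi (h ▸ k.2)

lemma finsetEmbed_injective (s : Finset ι) (E : ∀ i, Submodule ℂ (G i)) :
    Function.Injective (finsetEmbed s E) := fun y z h => by
  funext i
  ext
  rw [← finsetEmbed_apply, h, finsetEmbed_apply]

lemma sum_natCast_le_sValCount_diagonal (hT : ∀ x i, T x i = D i (x i)) {c : ℝ} (hc : 0 < c)
    (s : Finset ι) (m : ι → ℕ) (hm : ∀ i ∈ s, ∀ j, m i = j + 1 → c < sVal (D i) j) :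
    ((∑ i ∈ s, m i : ℕ) : ℝ≥0∞) ≤ sValCount T c := by
  obtain ⟨c', hcc', hc'⟩ : ∃ c' > c, ∀ i ∈ s, ∀ j, m i = j + 1 → c' < sVal (D i) j := by
    have h1 : ∀ᶠ c' in nhdsWithin c (Set.Ioi c), ∀ i ∈ s, ∀ j, m i = j + 1 → c' < sVal (D i) j := by
      rw [Filter.eventually_all_finset]
      intro i hi
      rcases hk : m i with _ | k
      · simp
      · filter_upwards [mem_nhdsWithin_of_mem_nhds (Iio_mem_nhds (hm i hi k hk))] with t ht j hj
        obtain rfl : k = j := by omega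
        exact ht
    obtain ⟨c', h2, h3⟩ := (h1.and self_mem_nhdsWithin).exists
    exact ⟨c', h3, h2⟩
  have hE : ∀ i, ∃ E : Submodule ℂ (G i), i ∈ s → (m i : Cardinal) ≤ Module.rank ℂ E ∧
      ∀ x ∈ E, c' * ‖x‖ ≤ ‖D i x‖ := fun i => by
    by_cases hi : i ∈ s
    · rcases hk : m i with _ | k
      · exact ⟨⊥, fun _ => ⟨by simp, by simp⟩⟩
      · obtain ⟨E, hE⟩ := exists_submodule_of_lt_sVal (hc.trans hcc') (hc' i hi k hk)
        exact ⟨E, fun _ => hE⟩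
    · exact ⟨⊥, fun h => absurd h hi⟩
  choose E hE using hE
  rcases hM : ∑ i ∈ s, m i with _ | M
  · simp
  refine natCast_le_sValCount (hcc'.trans_le ?_)
  refine le_sVal_of_submodule (LinearMap.range (finsetEmbed s E)) ?_ ?_
  · rw [rank_range_of_injective _ (finsetEmbed_injective s E), rank_pi, ← hM]
    have h1 : ((∑ i ∈ s, m i : ℕ) : Cardinal) = Cardinal.sum fun i : s => (m i : Cardinal) := by
      have h2 := Cardinal.mk_sigma fun i : s => Fin (m i)
      rw [Cardinal.mk_fintype, Fintype.card_sigma] at h2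
      simp only [Fintype.card_fin, Cardinal.mk_fin] at h2
      rw [← h2, Finset.sum_coe_sort s m]
    rw [h1]
    exact Cardinal.sum_le_sum _ _ fun i => (hE i i.2).1
  · rintro _ ⟨y, rfl⟩
    refine mul_norm_le_of_diagonal hT (hc.trans hcc').le fun i => ?_
    by_cases hi : i ∈ s
    · rw [finsetEmbed_apply s E y ⟨i, hi⟩]
      exact (hE i hi).2 _ (y ⟨i, hi⟩).2
    · simp [finsetEmbed_apply_of_notMem s E y hi]

lemma tsum_sValCount_le_diagonal (hT : ∀ x i, T x i = D i (x i)) {c : ℝ} (hc : 0 < c) :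
    ∑' i, sValCount (D i) c ≤ sValCount T c := by
  rw [ENNReal.tsum_eq_iSup_sum]
  refine iSup_le fun s => ?_
  have h1 : ∀ i, sValCount (D i) c
      = ⨆ k : ℕ, ((((Finset.range k).filter fun j => c < sVal (D i) j).card : ℕ) : ℝ≥0∞) :=
    fun i => by
      rw [sValCount, ENNReal.tsum_eq_iSup_nat]
      simp only [Finset.sum_boole]
  simp only [h1]
  rw [ENNReal.finsetSum_iSup_of_monotone]
  · refine iSup_le fun k => ?_
    rw [← Nat.cast_sum]
    refine sum_natCast_le_sValCount_diagonal hT hc s _ fun i _ j hj => ?_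
    by_contra! hle
    have hsub : (Finset.range k).filter (fun j => c < sVal (D i) j) ⊆ Finset.range j := by
      intro l hl
      rw [Finset.mem_filter] at hl
      rw [Finset.mem_range]
      by_contra! hjl
      exact (hl.2.trans_le ((sVal_antitone (D i) hjl).trans hle)).false
    have := Finset.card_le_card hsub
    rw [Finset.card_range] at this
    omega
  · intro i k l hkl
    simp only [Nat.cast_le]
    exact Finset.card_le_card (Finset.filter_subset_filter _ (Finset.range_mono hkl))

/-- The `p`-th power sum of singular values is additive over Hilbert sums. -/
lemma schSum_diagonal [Countable ι] (hT : ∀ x i, T x i = D i (x i)) {p : ℝ} (hp : 0 < p) :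
    schSum p T = ∑' i, schSum p (D i) := by
  simp only [schSum_eq_lintegral hp]
  rw [← lintegral_tsum fun i => (measurable_sValCount p (D i)).aemeasurable]
  refine setLIntegral_congr_fun measurableSet_Ioi fun t ht => ?_
  have ht' : 0 < t ^ (1 / p) := Real.rpow_pos_of_pos ht _
  exact le_antisymm (sValCount_diagonal_le hT ht'.le) (tsum_sValCount_le_diagonal hT ht')

end DirectSum

section UnitaryCalculus

variable {H K : Type} [NormedAddCommGroup H] [InnerProductSpace ℂ H] [CompleteSpace H]
  [NormedAddCommGroup K] [InnerProductSpace ℂ K] [CompleteSpace K]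

lemma comp_cfc_eq_cfc_comp {A : H →L[ℂ] H} {B : K →L[ℂ] K} (hA : A ∈ unitary (H →L[ℂ] H))
    (hB : B ∈ unitary (K →L[ℂ] K)) (L : H →L[ℂ] K) (h : L ∘L A = B ∘L L)
    (hstar : L ∘L star A = star B ∘L L) {f : ℂ → ℂ}
    (hf : ContinuousOn f (Metric.sphere (0 : ℂ) 1)) :
    L ∘L cfc f A = cfc f B ∘L L := by
  have hAn := isStarNormal_of_mem_unitary hA
  have hBn := isStarNormal_of_mem_unitary hB
  have hAs := spectrum.subset_circle_of_unitary (𝕜 := ℂ) hA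
  have hBs := spectrum.subset_circle_of_unitary (𝕜 := ℂ) hB
  have key : ∀ g : C(Metric.sphere (0 : ℂ) 1, ℂ),
      L ∘L cfcHomSuperset hAn hAs g = cfcHomSuperset hBn hBs g ∘L L := by
    intro g
    induction g using ContinuousMap.induction_on_of_compact with
    | const r =>
      have h1 : ContinuousMap.const (Metric.sphere (0 : ℂ) 1) r = algebraMap ℂ _ r := rfl
      rw [h1, AlgHomClass.commutes, AlgHomClass.commutes]
      ext x
      simp [Algebra.algebraMap_eq_smul_one]
    | id => rw [cfcHomSuperset_id, cfcHomSuperset_id, h]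
    | star_id => rw [map_star, map_star, cfcHomSuperset_id, cfcHomSuperset_id, hstar]
    | add g₁ g₂ h₁ h₂ =>
      rw [map_add, map_add, ContinuousLinearMap.comp_add, ContinuousLinearMap.add_comp, h₁, h₂]
    | mul g₁ g₂ h₁ h₂ =>
      rw [map_mul, map_mul]
      change L ∘L (_ ∘L _) = (_ ∘L _) ∘L L
      rw [← ContinuousLinearMap.comp_assoc, h₁, ContinuousLinearMap.comp_assoc, h₂,
        ContinuousLinearMap.comp_assoc]
    | frequently g hg =>
      refine hg.mem_of_closed (isClosed_eq ?_ ?_)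
      · exact (ContinuousLinearMap.compL ℂ H H K L).continuous.comp
          (cfcHomSuperset_continuous hAn hAs)
      · exact ((ContinuousLinearMap.compL ℂ H K K).flip L).continuous.comp
          (cfcHomSuperset_continuous hBn hBs)
  have := key ⟨_, hf.domRestrict⟩
  rw [cfc_apply f A hAn (hf.mono hAs), cfc_apply f B hBn (hf.mono hBs)]
  exact this

end UnitaryCalculus

section DirectSum

open scoped ENNReal

variable {ι : Type} {G : ι → Type} [∀ i, NormedAddCommGroup (G i)]
  [∀ i, InnerProductSpace ℂ (G i)] [∀ i, CompleteSpace (G i)]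

/-- The orthogonal direct sum of a uniformly bounded family of operators. -/
def directSumOp (D : ∀ i, G i →L[ℂ] G i) (hD : ∀ i, ‖D i‖ ≤ 1) : lp G 2 →L[ℂ] lp G 2 :=
  lp.mapCLM 2 D zero_le_one hD

lemma directSumOp_apply (D : ∀ i, G i →L[ℂ] G i) (hD : ∀ i, ‖D i‖ ≤ 1) (x : lp G 2) (i : ι) :
    directSumOp D hD x i = D i (x i) := rfl

lemma norm_le_one_of_mem_unitary {H : Type} [NormedAddCommGroup H] [InnerProductSpace ℂ H]
    [CompleteSpace H] {U : H →L[ℂ] H} (hU : U ∈ unitary (H →L[ℂ] H)) : ‖U‖ ≤ 1 := by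
  rcases subsingleton_or_nontrivial (H →L[ℂ] H) with h | h
  · simp [Subsingleton.elim U 0]
  · exact (CStarRing.norm_of_mem_unitary hU).le

lemma star_directSumOp (D : ∀ i, G i →L[ℂ] G i) (hD : ∀ i, ‖D i‖ ≤ 1) :
    star (directSumOp D hD) = directSumOp (fun i => star (D i)) fun i => by
      rw [norm_star]; exact hD i := by
  rw [ContinuousLinearMap.star_eq_adjoint, eq_comm, ContinuousLinearMap.eq_adjoint_iff]
  intro x y
  rw [lp.inner_eq_tsum, lp.inner_eq_tsum]
  refine tsum_congr fun i => ?_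
  rw [directSumOp_apply, directSumOp_apply, ContinuousLinearMap.star_eq_adjoint,
    ContinuousLinearMap.adjoint_inner_left]

variable {U V : ∀ i, G i →L[ℂ] G i}

/-- The orthogonal direct sum of a family of unitary operators. -/
def directSumUnitary (hU : ∀ i, U i ∈ unitary (G i →L[ℂ] G i)) : lp G 2 →L[ℂ] lp G 2 :=
  directSumOp U fun i => norm_le_one_of_mem_unitary (hU i)

lemma directSumUnitary_mem (hU : ∀ i, U i ∈ unitary (G i →L[ℂ] G i)) :
    directSumUnitary hU ∈ unitary (lp G 2 →L[ℂ] lp G 2) := by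
  rw [Unitary.mem_iff, directSumUnitary, star_directSumOp]
  constructor
  all_goals
    ext x i
    simp only [mul_apply_eq_comp, directSumOp_apply]
    rw [← mul_apply_eq_comp]
  · rw [Unitary.star_mul_self_of_mem (hU i)]; rfl
  · rw [Unitary.mul_star_self_of_mem (hU i)]; rfl

lemma cfc_directSumUnitary_apply (hU : ∀ i, U i ∈ unitary (G i →L[ℂ] G i)) {f : ℂ → ℂ}
    (hf : ContinuousOn f (Metric.sphere (0 : ℂ) 1)) (x : lp G 2) (i : ι) :
    cfc f (directSumUnitary hU) x i = cfc f (U i) (x i) := by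
  refine DFunLike.congr_fun (comp_cfc_eq_cfc_comp (directSumUnitary_mem hU) (hU i)
    (lp.evalCLM ℂ G 2 i) ?_ ?_ hf) x
  · rfl
  · rw [directSumUnitary, star_directSumOp]
    rfl

lemma schSum_directSumUnitary_sub [Countable ι] {p : ℝ} (hp : 0 < p)
    (hU : ∀ i, U i ∈ unitary (G i →L[ℂ] G i)) (hV : ∀ i, V i ∈ unitary (G i →L[ℂ] G i)) :
    schSum p (directSumUnitary hU - directSumUnitary hV) = ∑' i, schSum p (U i - V i) :=
  schSum_diagonal (fun _ _ => rfl) hp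

lemma schSum_cfc_directSumUnitary_sub [Countable ι] {q : ℝ} (hq : 0 < q)
    (hU : ∀ i, U i ∈ unitary (G i →L[ℂ] G i)) (hV : ∀ i, V i ∈ unitary (G i →L[ℂ] G i))
    {f : ℂ → ℂ} (hf : ContinuousOn f (Metric.sphere (0 : ℂ) 1)) :
    schSum q (cfc f (directSumUnitary hU) - cfc f (directSumUnitary hV))
      = ∑' i, schSum q (cfc f (U i) - cfc f (V i)) := by
  refine schSum_diagonal (fun x i => ?_) hq
  rw [sub_apply, lp.coeFn_sub, Pi.sub_apply, cfc_directSumUnitary_apply hU hf,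
    cfc_directSumUnitary_apply hV hf, sub_apply]

lemma separableSpace_lp_two [Countable ι] [∀ i, TopologicalSpace.SeparableSpace (G i)] :
    TopologicalSpace.SeparableSpace (lp G 2) := by
  classical
  let S : Set (lp G 2) := ⋃ i, Set.range (lp.single 2 i : G i → lp G 2)
  have hS : TopologicalSpace.IsSeparable S := by
    refine TopologicalSpace.IsSeparable.iUnion fun i => ?_
    exact TopologicalSpace.isSeparable_range
      (lp.singleContinuousLinearMap ℂ G 2 i).continuous
  have h2 := (hS.span (R := ℂ)).closure
  rw [← TopologicalSpace.isSeparable_univ_iff]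
  refine h2.mono fun x _ => ?_
  refine mem_closure_of_tendsto (lp.hasSum_single (by simp) x) (Filter.Eventually.of_forall ?_)
  intro s
  exact Submodule.sum_mem _ fun i _ => Submodule.subset_span (Set.mem_iUnion.2 ⟨i, _, rfl⟩)

end DirectSum

section Rotation

open scoped ENNReal

variable {H : Type} [NormedAddCommGroup H] [InnerProductSpace ℂ H] [CompleteSpace H]

lemma schSum_zero {q : ℝ} (hq : 0 < q) : schSum q (0 : H →L[ℂ] H) = 0 := by
  refine ENNReal.tsum_eq_zero.2 fun j => ?_
  have : sVal (0 : H →L[ℂ] H) j = 0 :=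
    le_antisymm ((sVal_antitone _ j.zero_le).trans (by simp [sVal_zero_eq_norm]))
      (sVal_nonneg _ _)
  rw [this, Real.zero_rpow hq.ne', ENNReal.ofReal_zero]

lemma schSum_le_of_sVal_le {q : ℝ} (hq : 0 < q) {S T : H →L[ℂ] H} {c : ℝ} (hc : 0 ≤ c)
    (h : ∀ j, sVal S j ≤ c * sVal T j) : schSum q S ≤ ENNReal.ofReal (c ^ q) * schSum q T := by
  rw [schSum, schSum, ← ENNReal.tsum_mul_left]
  refine ENNReal.tsum_le_tsum fun j => ?_
  rw [← ENNReal.ofReal_mul (Real.rpow_nonneg hc q), ← Real.mul_rpow hc (sVal_nonneg T j)]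
  exact ENNReal.ofReal_le_ofReal (Real.rpow_le_rpow (sVal_nonneg S j) (h j) hq.le)

lemma schSum_mul_mul_le {q : ℝ} (hq : 0 < q) (A T B : H →L[ℂ] H) (hA : ‖A‖ ≤ 1) (hB : ‖B‖ ≤ 1) :
    schSum q (A * T * B) ≤ schSum q T := by
  have := schSum_le_of_sVal_le hq zero_le_one (S := A * T * B) (T := T) fun j => by
    have h1 := sVal_mul_le' (A * T) B j
    have h2 := sVal_mul_le A T j
    have h3 := sVal_nonneg T j
    have h4 := sVal_nonneg (A * T) j
    calc sVal (A * T * B) j ≤ sVal (A * T) j * ‖B‖ := h1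
      _ ≤ sVal (A * T) j * 1 := by gcongr
      _ ≤ ‖A‖ * sVal T j := by linarith
      _ ≤ 1 * sVal T j := by gcongr
  simpa using this

lemma schSum_add_le {q : ℝ} (hq : 0 < q) (S T : H →L[ℂ] H) :
    schSum q (S + T) ≤ 2 * ENNReal.ofReal (2 ^ q) * (schSum q S + schSum q T) := by
  have h1 : ∀ j, ENNReal.ofReal (sVal (S + T) (j + j) ^ q) ≤
      ENNReal.ofReal (2 ^ q) * (ENNReal.ofReal (sVal S j ^ q) + ENNReal.ofReal (sVal T j ^ q)) := by
    intro j
    have hS := sVal_nonneg S j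
    have hT := sVal_nonneg T j
    have hS' := Real.rpow_nonneg hS q
    have hT' := Real.rpow_nonneg hT q
    rw [← ENNReal.ofReal_add hS' hT', ← ENNReal.ofReal_mul (by positivity)]
    refine ENNReal.ofReal_le_ofReal ?_
    refine (Real.rpow_le_rpow (sVal_nonneg _ _) (sVal_add_le S T j j) hq.le).trans ?_
    rcases le_total (sVal S j) (sVal T j) with h | h
    · calc (sVal S j + sVal T j) ^ q ≤ (2 * sVal T j) ^ q :=
            Real.rpow_le_rpow (by positivity) (by linarith) hq.le
        _ = 2 ^ q * sVal T j ^ q := Real.mul_rpow (by norm_num) hT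
        _ ≤ _ := by gcongr; linarith
    · calc (sVal S j + sVal T j) ^ q ≤ (2 * sVal S j) ^ q :=
            Real.rpow_le_rpow (by positivity) (by linarith) hq.le
        _ = 2 ^ q * sVal S j ^ q := Real.mul_rpow (by norm_num) hS
        _ ≤ _ := by gcongr; linarith
  have h2 : schSum q (S + T) ≤ 2 * ∑' j, ENNReal.ofReal (sVal (S + T) (j + j) ^ q) := by
    rw [schSum, ← tsum_even_add_odd ENNReal.summable ENNReal.summable, two_mul]
    simp only [two_mul]
    gcongr with j
    · exact sVal_nonneg _ _
    · exact sVal_antitone _ (Nat.le_succ _)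
  refine h2.trans ?_
  rw [mul_assoc]
  gcongr
  rw [schSum, schSum, ← ENNReal.tsum_add, ← ENNReal.tsum_mul_left]
  exact ENNReal.tsum_le_tsum h1

/-- The constant in the quasi-triangle inequality for sums of `n` operators. -/
def schSumConst (q : ℝ) (n : ℕ) : ℝ≥0∞ := (2 * (2 * ENNReal.ofReal (2 ^ q))) ^ n

lemma schSumConst_lt_top (q : ℝ) (n : ℕ) : schSumConst q n < ⊤ := by
  unfold schSumConst
  finiteness

lemma one_le_schSumConst {q : ℝ} (hq : 0 < q) (n : ℕ) : 1 ≤ schSumConst q n := by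
  refine one_le_pow₀ ?_
  have : (1 : ℝ≥0∞) ≤ ENNReal.ofReal (2 ^ q) :=
    ENNReal.one_le_ofReal.2 (Real.one_le_rpow one_le_two hq.le)
  calc (1 : ℝ≥0∞) = 1 * (1 * 1) := by simp
    _ ≤ _ := by gcongr <;> exact one_le_two

lemma schSum_sum_le {q : ℝ} (hq : 0 < q) (T : ℕ → H →L[ℂ] H) {t : ℝ≥0∞}
    (hT : ∀ k, schSum q (T k) ≤ t) (n : ℕ) :
    schSum q (∑ k ∈ Finset.range n, T k) ≤ schSumConst q n * t := by
  induction n with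
  | zero => simp [schSum_zero hq]
  | succ n ih =>
    rw [Finset.sum_range_succ]
    refine (schSum_add_le hq _ _).trans ?_
    have h1 : t ≤ schSumConst q n * t := le_mul_of_one_le_left' (one_le_schSumConst hq n)
    calc 2 * ENNReal.ofReal (2 ^ q) * (schSum q (∑ k ∈ Finset.range n, T k) + schSum q (T n))
        ≤ 2 * ENNReal.ofReal (2 ^ q) * (schSumConst q n * t + schSumConst q n * t) := by
          gcongr
          exact (hT n).trans h1
      _ = schSumConst q (n + 1) * t := by
          rw [schSumConst, schSumConst, pow_succ]; ring

lemma cfc_unitary_conj {A R : H →L[ℂ] H} (hA : A ∈ unitary (H →L[ℂ] H))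
    (hR : R ∈ unitary (H →L[ℂ] H)) {f : ℂ → ℂ} (hf : ContinuousOn f (Metric.sphere (0 : ℂ) 1)) :
    cfc f (R * A * star R) = R * cfc f A * star R := by
  have hR1 := Unitary.star_mul_self_of_mem hR
  have hR2 := Unitary.mul_star_self_of_mem hR
  have hX : R * A * star R ∈ unitary (H →L[ℂ] H) := mul_mem (mul_mem hR hA) (Unitary.star_mem hR)
  have h : R * cfc f A = cfc f (R * A * star R) * R := by
    refine comp_cfc_eq_cfc_comp hA hX R ?_ ?_ hf
    · change R * A = R * A * star R * R
      rw [mul_assoc, hR1, mul_one]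
    · change R * star A = star (R * A * star R) * R
      rw [star_mul, star_star, star_mul]
      simp only [mul_assoc, hR1, mul_one]
  rw [h, mul_assoc _ R (star R), hR2, mul_one]

/-- The rotation `cos φ + J sin φ` by the angle `φ` determined by an operator `J` with
`J² = -1`. -/
def opRotation (J : H →L[ℂ] H) (φ : ℝ) : H →L[ℂ] H :=
  ((Real.cos φ : ℝ) : ℂ) • 1 + ((Real.sin φ : ℝ) : ℂ) • J

variable {J : H →L[ℂ] H}

lemma opRotation_mul (hJ : J * J = -1) (φ ψ : ℝ) :
    opRotation J φ * opRotation J ψ = opRotation J (φ + ψ) := by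
  simp only [opRotation, Real.cos_add, Real.sin_add, add_mul, mul_add, smul_mul_assoc,
    mul_smul_comm, one_mul, mul_one, hJ]
  push_cast
  module

lemma opRotation_pow (hJ : J * J = -1) (φ : ℝ) (n : ℕ) :
    opRotation J φ ^ n = opRotation J (n * φ) := by
  induction n with
  | zero => simp [opRotation]
  | succ n ih =>
    rw [pow_succ, ih, opRotation_mul hJ]
    push_cast
    ring_nf

lemma star_opRotation (hJs : star J = -J) (φ : ℝ) : star (opRotation J φ) = opRotation J (-φ) := by
  simp only [opRotation, star_add, star_smul, hJs, star_one, Real.cos_neg, Real.sin_neg,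
    Complex.star_def, Complex.conj_ofReal]
  push_cast
  module

lemma opRotation_mem_unitary (hJ : J * J = -1) (hJs : star J = -J) (φ : ℝ) :
    opRotation J φ ∈ unitary (H →L[ℂ] H) := by
  rw [Unitary.mem_iff, star_opRotation hJs, opRotation_mul hJ, opRotation_mul hJ]
  simp [opRotation]

lemma opRotation_conj_sub (hJ : J * J = -1) (hJs : star J = -J) (A : H →L[ℂ] H) (φ : ℝ) :
    opRotation J φ * A * star (opRotation J φ) - A =
      ((Real.sin φ : ℝ) : ℂ) • ((J * A * star J - A) * (J * star (opRotation J φ))) := by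
  have h1 := Unitary.mul_star_self_of_mem (opRotation_mem_unitary hJ hJs φ)
  have h2 : opRotation J φ * A - A * opRotation J φ =
      ((Real.sin φ : ℝ) : ℂ) • ((J * A * star J - A) * J) := by
    rw [hJs]
    simp only [opRotation, add_mul, mul_add, smul_mul_assoc, mul_smul_comm, one_mul, mul_one,
      sub_mul, mul_neg, neg_mul, mul_assoc, hJ]
    simp only [neg_neg]
    module
  calc opRotation J φ * A * star (opRotation J φ) - A
      = (opRotation J φ * A - A * opRotation J φ) * star (opRotation J φ) := by
        rw [sub_mul, mul_assoc A, h1, mul_one]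
    _ = _ := by rw [h2, smul_mul_assoc, mul_assoc]

lemma schSum_opRotation_conj_sub_le (hJ : J * J = -1) (hJs : star J = -J) {p : ℝ} (hp : 0 < p)
    (A : H →L[ℂ] H) (φ : ℝ) :
    schSum p (opRotation J φ * A * star (opRotation J φ) - A) ≤
      ENNReal.ofReal (|Real.sin φ| ^ p) * schSum p (J * A * star J - A) := by
  have hJu : J ∈ unitary (H →L[ℂ] H) := by
    rw [Unitary.mem_iff, hJs, neg_mul, mul_neg, hJ, neg_neg]
    exact ⟨rfl, rfl⟩
  have hn : ‖J * star (opRotation J φ)‖ ≤ 1 := norm_le_one_of_mem_unitary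
    (mul_mem hJu (Unitary.star_mem (opRotation_mem_unitary hJ hJs φ)))
  refine schSum_le_of_sVal_le hp (abs_nonneg _) fun j => ?_
  rw [opRotation_conj_sub hJ hJs, ← mul_smul_comm]
  refine (sVal_mul_le' _ _ j).trans ?_
  rw [mul_comm]
  refine mul_le_mul_of_nonneg_right ?_ (sVal_nonneg _ _)
  rw [norm_smul, Complex.norm_real, Real.norm_eq_abs]
  exact mul_le_of_le_one_right (abs_nonneg _) hn

lemma schSum_cfc_conj_sub_le (hJ : J * J = -1) (hJs : star J = -J) {q : ℝ} (hq : 0 < q)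
    {A : H →L[ℂ] H} (hA : A ∈ unitary (H →L[ℂ] H)) {f : ℂ → ℂ}
    (hf : ContinuousOn f (Metric.sphere (0 : ℂ) 1)) {n : ℕ} (hn : n ≠ 0) :
    schSum q (cfc f (J * A * star J) - cfc f A) ≤ schSumConst q n *
      schSum q (cfc f (opRotation J (Real.pi / 2 / n) * A * star (opRotation J (Real.pi / 2 / n)))
        - cfc f A) := by
  set R := opRotation J (Real.pi / 2 / n) with hR
  have hRu : R ∈ unitary (H →L[ℂ] H) := opRotation_mem_unitary hJ hJs _
  have hJR : J = R ^ n := by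
    rw [hR, opRotation_pow hJ, mul_div_cancel₀ _ (Nat.cast_ne_zero.2 hn)]
    simp [opRotation]
  have hJu : J ∈ unitary (H →L[ℂ] H) := hJR ▸ pow_mem hRu n
  have htel : cfc f (J * A * star J) - cfc f A = ∑ k ∈ Finset.range n,
      R ^ k * (cfc f (R * A * star R) - cfc f A) * star R ^ k := by
    have h1 : ∀ k, R ^ k * (cfc f (R * A * star R) - cfc f A) * star R ^ k =
        R ^ (k + 1) * cfc f A * star R ^ (k + 1) - R ^ k * cfc f A * star R ^ k := fun k => by
      rw [cfc_unitary_conj hA hRu hf, pow_succ, pow_succ' (star R)]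
      noncomm_ring
    rw [Finset.sum_congr rfl fun k _ => h1 k,
      Finset.sum_range_sub fun k => R ^ k * cfc f A * star R ^ k, cfc_unitary_conj hA hJu hf, hJR,
      star_pow]
    simp
  rw [htel]
  refine schSum_sum_le hq _ (fun k => ?_) n
  exact schSum_mul_mul_le hq _ _ _ (norm_le_one_of_mem_unitary (pow_mem hRu k))
    (norm_le_one_of_mem_unitary (pow_mem (Unitary.star_mem hRu) k))

end Rotation

section Halving

open scoped ENNReal

variable {H : Type} [NormedAddCommGroup H] [InnerProductSpace ℂ H] [CompleteSpace H]

variable (H) in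
/-- The operator `(x, y) ↦ (-y, x)` on `H ⊕ H`. -/
def quarterTurn : lp (fun _ : Bool => H) 2 →L[ℂ] lp (fun _ : Bool => H) 2 :=
  lp.singleContinuousLinearMap ℂ (fun _ : Bool => H) 2 true ∘L
      lp.evalCLM ℂ (fun _ : Bool => H) 2 false -
    lp.singleContinuousLinearMap ℂ (fun _ : Bool => H) 2 false ∘L
      lp.evalCLM ℂ (fun _ : Bool => H) 2 true

lemma quarterTurn_apply_true (x : lp (fun _ : Bool => H) 2) :
    quarterTurn H x true = x false := by
  have h : quarterTurn H x = lp.single 2 true (x false) - lp.single 2 false (x true) := rfl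
  rw [h, lp.coeFn_sub, Pi.sub_apply, lp.single_apply_self,
    lp.single_apply_ne (E := fun _ : Bool => H) 2 false _ (by decide), sub_zero]

lemma quarterTurn_apply_false (x : lp (fun _ : Bool => H) 2) :
    quarterTurn H x false = -x true := by
  have h : quarterTurn H x = lp.single 2 true (x false) - lp.single 2 false (x true) := rfl
  rw [h, lp.coeFn_sub, Pi.sub_apply, lp.single_apply_self,
    lp.single_apply_ne (E := fun _ : Bool => H) 2 true _ (by decide), zero_sub]

lemma quarterTurn_mul_self : quarterTurn H * quarterTurn H = -1 := by
  ext x b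
  change quarterTurn H (quarterTurn H x) b = -x b
  cases b
  · rw [quarterTurn_apply_false, quarterTurn_apply_true]
  · rw [quarterTurn_apply_true, quarterTurn_apply_false]

lemma star_quarterTurn : star (quarterTurn H) = -quarterTurn H := by
  rw [ContinuousLinearMap.star_eq_adjoint, eq_comm, ContinuousLinearMap.eq_adjoint_iff]
  intro x y
  have h : (-quarterTurn H) x = -quarterTurn H x := rfl
  rw [h, inner_neg_left, lp.inner_eq_tsum, lp.inner_eq_tsum, tsum_bool, tsum_bool,
    quarterTurn_apply_false, quarterTurn_apply_true, quarterTurn_apply_false,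
    quarterTurn_apply_true]
  simp only [inner_neg_left, inner_neg_right]
  ring

lemma quarterTurn_conj {A B : lp (fun _ : Bool => H) 2 →L[ℂ] lp (fun _ : Bool => H) 2}
    {D : Bool → H →L[ℂ] H} (hA : ∀ x b, A x b = D b (x b)) (hB : ∀ x b, B x b = D (!b) (x b)) :
    quarterTurn H * A * star (quarterTurn H) = B := by
  have h1 : quarterTurn H * A = B * quarterTurn H := by
    ext x b
    change quarterTurn H (A x) b = B (quarterTurn H x) b
    rw [hB]
    cases b
    · rw [quarterTurn_apply_false, quarterTurn_apply_false, hA, map_neg]; rfl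
    · rw [quarterTurn_apply_true, quarterTurn_apply_true, hA]; rfl
  rw [h1, star_quarterTurn, mul_neg, mul_assoc, quarterTurn_mul_self, mul_neg, neg_neg, mul_one]

lemma schSum_neg {p : ℝ} (hp : 0 < p) (T : H →L[ℂ] H) : schSum p (-T) ≤ schSum p T := by
  have h := schSum_le_of_sVal_le hp zero_le_one (S := -T) (T := T) fun j => by
    have h1 := sVal_mul_le (-1) T j
    rw [neg_one_mul, norm_neg] at h1
    exact h1.trans (mul_le_mul_of_nonneg_right ContinuousLinearMap.norm_id_le (sVal_nonneg T j))
  simpa using h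

lemma schSum_sub_comm {p : ℝ} (hp : 0 < p) (S T : H →L[ℂ] H) :
    schSum p (S - T) = schSum p (T - S) :=
  le_antisymm (by simpa using schSum_neg hp (T - S)) (by simpa using schSum_neg hp (S - T))

lemma exists_unitary_pair_schSum_le {p q : ℝ} (hp : 0 < p) (hq : 0 < q)
    {U V : H →L[ℂ] H} (hU : U ∈ unitary (H →L[ℂ] H)) (hV : V ∈ unitary (H →L[ℂ] H)) {f : ℂ → ℂ}
    (hf : ContinuousOn f (Metric.sphere (0 : ℂ) 1)) {n : ℕ} (hn : n ≠ 0) :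
    ∃ X Y : lp (fun _ : Bool => H) 2 →L[ℂ] lp (fun _ : Bool => H) 2,
      X ∈ unitary (lp (fun _ : Bool => H) 2 →L[ℂ] lp (fun _ : Bool => H) 2) ∧
      Y ∈ unitary (lp (fun _ : Bool => H) 2 →L[ℂ] lp (fun _ : Bool => H) 2) ∧
      schSum p (X - Y) ≤
        ENNReal.ofReal (|Real.sin (Real.pi / 2 / n)| ^ p) * (2 * schSum p (U - V)) ∧
      schSum q (cfc f U - cfc f V) ≤ schSumConst q n * schSum q (cfc f X - cfc f Y) := by
  have hA : ∀ b, (fun b : Bool => bif b then U else V) b ∈ unitary (H →L[ℂ] H) := by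
    rintro (_ | _) <;> assumption
  have hB : ∀ b, (fun b : Bool => bif !b then U else V) b ∈ unitary (H →L[ℂ] H) := by
    rintro (_ | _) <;> assumption
  set A := directSumUnitary (G := fun _ : Bool => H) hA with hAdef
  set B := directSumUnitary (G := fun _ : Bool => H) hB with hBdef
  have hAB : quarterTurn H * A * star (quarterTurn H) = B :=
    quarterTurn_conj (D := fun b : Bool => bif b then U else V) (fun _ _ => rfl) fun _ _ => rfl
  have hAu := directSumUnitary_mem (G := fun _ : Bool => H) hA
  have hRu := opRotation_mem_unitary quarterTurn_mul_self (star_quarterTurn (H := H))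
    (Real.pi / 2 / n)
  refine ⟨_, A, mul_mem (mul_mem hRu hAu) (Unitary.star_mem hRu), hAu,
    (schSum_opRotation_conj_sub_le quarterTurn_mul_self star_quarterTurn hp A
      (Real.pi / 2 / n)).trans ?_, le_trans ?_ (schSum_cfc_conj_sub_le quarterTurn_mul_self
        star_quarterTurn hq hAu hf hn)⟩
  · gcongr
    rw [hAB, schSum_directSumUnitary_sub (G := fun _ : Bool => H) hp hB hA, tsum_bool, two_mul]
    exact add_le_add le_rfl (schSum_sub_comm hp V U).le
  · rw [hAB, schSum_cfc_directSumUnitary_sub (G := fun _ : Bool => H) hq hB hA hf, tsum_bool]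
    exact le_self_add

end Halving

section Modulus

open scoped ENNReal

lemma le_Omega {H : Type} [NormedAddCommGroup H] [InnerProductSpace ℂ H] [CompleteSpace H]
    [TopologicalSpace.SeparableSpace H] {p q δ : ℝ} (hp : 0 < p) (hδ : 0 ≤ δ) (f : ℂ → ℂ)
    {U V : H →L[ℂ] H} (hU : U ∈ unitary (H →L[ℂ] H)) (hV : V ∈ unitary (H →L[ℂ] H))
    (h : schSum p (U - V) ≤ ENNReal.ofReal (δ ^ p)) :
    schSum q (cfc f U - cfc f V) ^ (1 / q) ≤ Omega f p q δ := by
  have h1 : schNormE p (U - V) ≤ ENNReal.ofReal δ := by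
    rw [← ENNReal.rpow_le_rpow_iff hp, schNormE_rpow hp, ENNReal.ofReal_rpow_of_nonneg hδ hp.le]
    exact h
  exact le_iSup (fun P : UnitaryPair p δ => P.val f q) ⟨H, U, V, hU, hV, h1⟩

lemma schSum_cfc_le_Omega_rpow {H : Type} [NormedAddCommGroup H] [InnerProductSpace ℂ H]
    [CompleteSpace H] [TopologicalSpace.SeparableSpace H] {p q δ : ℝ} (hp : 0 < p) (hq : 0 < q)
    (hδ : 0 ≤ δ) (f : ℂ → ℂ)
    {U V : H →L[ℂ] H} (hU : U ∈ unitary (H →L[ℂ] H)) (hV : V ∈ unitary (H →L[ℂ] H))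
    (h : schSum p (U - V) ≤ ENNReal.ofReal (δ ^ p)) :
    schSum q (cfc f U - cfc f V) ≤ Omega f p q δ ^ q := by
  rw [← schNormE_rpow hq]
  exact ENNReal.rpow_le_rpow (le_Omega hp hδ f hU hV h) hq.le

lemma Omega_le {f : ℂ → ℂ} {p q δ : ℝ} (hp : 0 < p) (hq : 0 < q) (hδ : 0 ≤ δ) {c : ℝ≥0∞}
    (h : ∀ (H : Type) [NormedAddCommGroup H] [InnerProductSpace ℂ H] [CompleteSpace H]
      [TopologicalSpace.SeparableSpace H] (U V : H →L[ℂ] H), U ∈ unitary (H →L[ℂ] H) →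
      V ∈ unitary (H →L[ℂ] H) → schSum p (U - V) ≤ ENNReal.ofReal (δ ^ p) →
      schSum q (cfc f U - cfc f V) ≤ c ^ q) :
    Omega f p q δ ≤ c := by
  refine iSup_le fun P => ?_
  obtain ⟨H, U, V, hU, hV, h1⟩ := P
  change schNormE q (cfc f U - cfc f V) ≤ c
  rw [← ENNReal.rpow_le_rpow_iff hq, schNormE_rpow hq]
  refine h H U V hU hV ?_
  rwa [← schNormE_rpow hp, ← ENNReal.ofReal_rpow_of_nonneg hδ hp.le, ENNReal.rpow_le_rpow_iff hp]

lemma exists_lt_schSum_of_lt_Omega {f : ℂ → ℂ} {p q δ : ℝ} (hp : 0 < p) (hq : 0 < q) (hδ : 0 ≤ δ)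
    {c : ℝ≥0∞} (h : c < Omega f p q δ) :
    ∃ (H : Type) (_ : NormedAddCommGroup H) (_ : InnerProductSpace ℂ H) (_ : CompleteSpace H)
      (_ : TopologicalSpace.SeparableSpace H) (U V : H →L[ℂ] H), U ∈ unitary (H →L[ℂ] H) ∧
      V ∈ unitary (H →L[ℂ] H) ∧ schSum p (U - V) ≤ ENNReal.ofReal (δ ^ p) ∧
      c ^ q < schSum q (cfc f U - cfc f V) := by
  by_contra! hcon
  refine h.not_ge (Omega_le hp hq hδ ?_)
  intro H i₁ i₂ i₃ i₄ U V hU hV hUV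
  exact hcon H i₁ i₂ i₃ i₄ U V hU hV hUV

lemma Omega_mono (f : ℂ → ℂ) {p q δ δ' : ℝ} (hp : 0 < p) (hq : 0 < q) (hδ : 0 ≤ δ)
    (h : δ ≤ δ') : Omega f p q δ ≤ Omega f p q δ' := by
  refine Omega_le hp hq hδ fun H _ _ _ _ U V hU hV hUV => ?_
  refine schSum_cfc_le_Omega_rpow hp hq (hδ.trans h) f hU hV (hUV.trans ?_)
  exact ENNReal.ofReal_le_ofReal (Real.rpow_le_rpow hδ h hp.le)

/-- Direct sums of `n` copies of a pair of unitary operators. -/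
lemma Omega_mul_natCast_rpow_le {f : ℂ → ℂ} (hf : ContinuousOn f (Metric.sphere (0 : ℂ) 1))
    {p q δ δ' : ℝ} (hp : 0 < p) (hq : 0 < q) (hδ : 0 ≤ δ) (hδ' : 0 ≤ δ') (n : ℕ)
    (h : n * δ ^ p ≤ δ' ^ p) :
    Omega f p q δ * (n : ℝ≥0∞) ^ (1 / q) ≤ Omega f p q δ' := by
  rcases eq_or_ne n 0 with rfl | hn
  · simp [hq]
  have hn0 : (n : ℝ≥0∞) ^ (1 / q) ≠ 0 := by simp [hn]
  have hnt : (n : ℝ≥0∞) ^ (1 / q) ≠ ⊤ :=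
    ENNReal.rpow_ne_top_of_nonneg (by positivity) (ENNReal.natCast_ne_top n)
  rw [← ENNReal.le_div_iff_mul_le (Or.inl hn0) (Or.inl hnt)]
  refine Omega_le hp hq hδ fun H _ _ _ _ U V hU hV hUV => ?_
  rw [ENNReal.div_rpow_of_nonneg _ _ hq.le, ← ENNReal.rpow_mul, one_div_mul_cancel hq.ne',
    ENNReal.rpow_one, ENNReal.le_div_iff_mul_le (Or.inl (by simpa using hn))
      (Or.inl (ENNReal.natCast_ne_top n))]
  have hU' : ∀ _ : Fin n, U ∈ unitary (H →L[ℂ] H) := fun _ => hU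
  have hV' : ∀ _ : Fin n, V ∈ unitary (H →L[ℂ] H) := fun _ => hV
  have hsep : TopologicalSpace.SeparableSpace (lp (fun _ : Fin n => H) 2) := separableSpace_lp_two
  have key := schSum_cfc_le_Omega_rpow (q := q) hp hq hδ' f
    (directSumUnitary_mem (G := fun _ : Fin n => H) hU')
    (directSumUnitary_mem (G := fun _ : Fin n => H) hV') (by
      rw [schSum_directSumUnitary_sub (G := fun _ : Fin n => H) hp hU' hV', tsum_fintype,
        Finset.sum_const, Finset.card_univ, Fintype.card_fin, nsmul_eq_mul]
      refine le_trans ?_ (ENNReal.ofReal_le_ofReal h)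
      rw [ENNReal.ofReal_mul (Nat.cast_nonneg n), ENNReal.ofReal_natCast]
      gcongr)
  rw [schSum_cfc_directSumUnitary_sub (G := fun _ : Fin n => H) hq hU' hV' hf, tsum_fintype,
        Finset.sum_const, Finset.card_univ, Fintype.card_fin, nsmul_eq_mul] at key
  rwa [mul_comm]

lemma exists_nat_two_mul_abs_sin_rpow_le {p ε : ℝ} (hp : 0 < p) (hε : 0 < ε) :
    ∃ n : ℕ, n ≠ 0 ∧ |Real.sin (Real.pi / 2 / n)| ^ p * 2 ≤ ε := by
  have h1 : Filter.Tendsto (fun n : ℕ => |Real.sin (Real.pi / 2 / n)| ^ p * 2) Filter.atTop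
      (nhds (|Real.sin 0| ^ p * 2)) := by
    refine Filter.Tendsto.mul_const _ (Filter.Tendsto.rpow_const ?_ (Or.inr hp.le))
    exact ((Real.continuous_sin.tendsto 0).comp
      (tendsto_const_div_atTop_nhds_zero_nat (Real.pi / 2))).abs
  rw [Real.sin_zero, abs_zero, Real.zero_rpow hp.ne', zero_mul] at h1
  obtain ⟨n, h2, h3⟩ := ((h1.eventually (gt_mem_nhds hε)).and (Filter.eventually_ne_atTop 0)).exists
  exact ⟨n, h3, h2.le⟩

lemma exists_Omega_le_mul_Omega_half {f : ℂ → ℂ} (hf : ContinuousOn f (Metric.sphere (0 : ℂ) 1))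
    {p q : ℝ} (hp : 0 < p) (hq : 0 < q) :
    ∃ C : ℝ≥0∞, C ≠ ⊤ ∧ ∀ δ : ℝ, 0 < δ → Omega f p q δ ≤ C * Omega f p q (δ / 2) := by
  obtain ⟨n, hn, hsin⟩ := exists_nat_two_mul_abs_sin_rpow_le hp
    (show (0 : ℝ) < (1 / 2) ^ p by positivity)
  refine ⟨schSumConst q n ^ (1 / q),
    ENNReal.rpow_ne_top_of_nonneg (by positivity) (schSumConst_lt_top q n).ne, fun δ hδ => ?_⟩
  refine Omega_le hp hq hδ.le fun H _ _ _ _ U V hU hV hUV => ?_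
  obtain ⟨X, Y, hX, hY, hXY, hle⟩ := exists_unitary_pair_schSum_le hp hq hU hV hf hn
  have hsep : TopologicalSpace.SeparableSpace (lp (fun _ : Bool => H) 2) := separableSpace_lp_two
  rw [ENNReal.mul_rpow_of_nonneg _ _ hq.le, ← ENNReal.rpow_mul, one_div_mul_cancel hq.ne',
    ENNReal.rpow_one]
  refine hle.trans ?_
  gcongr
  refine schSum_cfc_le_Omega_rpow hp hq (by positivity) f hX hY (hXY.trans ?_)
  calc ENNReal.ofReal (|Real.sin (Real.pi / 2 / n)| ^ p) * (2 * schSum p (U - V))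
      = ENNReal.ofReal (|Real.sin (Real.pi / 2 / n)| ^ p * 2) * schSum p (U - V) := by
        rw [ENNReal.ofReal_mul (by positivity), ← mul_assoc]; simp
    _ ≤ ENNReal.ofReal ((1 / 2) ^ p) * ENNReal.ofReal (δ ^ p) := by gcongr
    _ = ENNReal.ofReal ((δ / 2) ^ p) := by
        rw [← ENNReal.ofReal_mul (by positivity), ← Real.mul_rpow (by positivity) hδ.le]
        ring_nf

end Modulus

section Limits

open scoped ENNReal
open Filter

lemma exists_Omega_le_one {f : ℂ → ℂ} (hf : ContinuousOn f (Metric.sphere (0 : ℂ) 1))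
    {p q : ℝ} (hp : 0 < p) (hq : 0 < q)
    (hyp : ∀ (H : Type) [NormedAddCommGroup H] [InnerProductSpace ℂ H] [CompleteSpace H]
      [TopologicalSpace.SeparableSpace H],
      ∀ U V : H →L[ℂ] H, U ∈ unitary (H →L[ℂ] H) → V ∈ unitary (H →L[ℂ] H) →
        MemSchatten p (U - V) → MemSchatten q (cfc f U - cfc f V)) :
    ∃ δ : ℝ, 0 < δ ∧ Omega f p q δ ≤ 1 := by
  by_contra! hcon
  have hex := fun n : ℕ => exists_lt_schSum_of_lt_Omega hp hq
    (show (0 : ℝ) ≤ ((1 / 2) ^ n) ^ (1 / p) by positivity)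
    (hcon (((1 / 2) ^ n) ^ (1 / p)) (by positivity))
  choose H i₁ i₂ i₃ i₄ U V hU hV h1 h2 using hex
  have hsep : TopologicalSpace.SeparableSpace (lp H 2) := separableSpace_lp_two
  have h3 := hyp (lp H 2) _ _ (directSumUnitary_mem hU) (directSumUnitary_mem hV) (by
    rw [memSchatten_iff, schSum_directSumUnitary_sub hp hU hV]
    have h4 : ∀ n, schSum p (U n - V n) ≤ ENNReal.ofReal ((1 / 2) ^ n) := fun n => by
      refine (h1 n).trans_eq ?_
      rw [← Real.rpow_mul (by positivity), one_div_mul_cancel hp.ne', Real.rpow_one]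
    exact ne_top_of_le_ne_top (summable_geometric_two).tsum_ofReal_ne_top
      (ENNReal.tsum_le_tsum h4))
  rw [memSchatten_iff, schSum_cfc_directSumUnitary_sub hq hU hV hf] at h3
  refine h3 (top_unique ?_)
  calc (⊤ : ℝ≥0∞) = ∑' _ : ℕ, (1 : ℝ≥0∞) := (ENNReal.tsum_const_eq_top_of_ne_zero one_ne_zero).symm
    _ ≤ _ := ENNReal.tsum_le_tsum fun n => by simpa using (h2 n).le

lemma Omega_lt_top {f : ℂ → ℂ} (hf : ContinuousOn f (Metric.sphere (0 : ℂ) 1))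
    {p q : ℝ} (hp : 0 < p) (hq : 0 < q)
    (hyp : ∀ (H : Type) [NormedAddCommGroup H] [InnerProductSpace ℂ H] [CompleteSpace H]
      [TopologicalSpace.SeparableSpace H],
      ∀ U V : H →L[ℂ] H, U ∈ unitary (H →L[ℂ] H) → V ∈ unitary (H →L[ℂ] H) →
        MemSchatten p (U - V) → MemSchatten q (cfc f U - cfc f V)) {δ : ℝ} (hδ : 0 < δ) :
    Omega f p q δ < ⊤ := by
  obtain ⟨δ₀, h0, h1⟩ := exists_Omega_le_one hf hp hq hyp
  obtain ⟨C, hC, h2⟩ := exists_Omega_le_mul_Omega_half hf hp hq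
  have h3 : ∀ n : ℕ, Omega f p q (2 ^ n * δ₀) < ⊤ := fun n => by
    induction n with
    | zero => simpa using h1.trans_lt ENNReal.one_lt_top
    | succ n ih =>
      refine (h2 _ (by positivity)).trans_lt ?_
      rw [pow_succ, show (2 : ℝ) ^ n * 2 * δ₀ / 2 = 2 ^ n * δ₀ by ring]
      exact ENNReal.mul_lt_top hC.lt_top ih
  obtain ⟨n, hn⟩ := pow_unbounded_of_one_lt (δ / δ₀) (one_lt_two : (1 : ℝ) < 2)
  exact (Omega_mono f hp hq hδ.le ((div_lt_iff₀ h0).1 hn).le).trans_lt (h3 n)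

lemma sVal_eq_zero_of_one_le (T : ℂ →L[ℂ] ℂ) {j : ℕ} (hj : 1 ≤ j) : sVal T j = 0 := by
  refine le_antisymm ((sVal_le T T ?_).trans_eq (by simp)) (sVal_nonneg T j)
  refine (LinearMap.rank_le_range _).trans ?_
  rw [Module.rank_self]
  exact_mod_cast hj

lemma schSum_complex {p : ℝ} (hp : 0 < p) (T : ℂ →L[ℂ] ℂ) :
    schSum p T = ENNReal.ofReal (‖T‖ ^ p) := by
  rw [schSum, tsum_eq_single 0, sVal_zero_eq_norm]
  intro j hj
  rw [sVal_eq_zero_of_one_le T (Nat.one_le_iff_ne_zero.2 hj), Real.zero_rpow hp.ne',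
    ENNReal.ofReal_zero]

lemma algebraMap_mem_unitary {ζ : ℂ} (hζ : ‖ζ‖ = 1) :
    algebraMap ℂ (ℂ →L[ℂ] ℂ) ζ ∈ unitary (ℂ →L[ℂ] ℂ) := by
  have h : starRingEnd ℂ ζ * ζ = 1 := by
    rw [Complex.conj_mul', hζ]; simp
  have h' : star (algebraMap ℂ (ℂ →L[ℂ] ℂ) ζ) = algebraMap ℂ (ℂ →L[ℂ] ℂ) (starRingEnd ℂ ζ) :=
    (algebraMap_star_comm ζ).symm
  rw [Unitary.mem_iff, h', ← map_mul, ← map_mul, h, mul_comm, h, map_one]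
  exact ⟨rfl, rfl⟩

lemma Omega_two_ne_zero {f : ℂ → ℂ} {p q : ℝ} (hp : 0 < p) (hq : 0 < q)
    {ζ τ : ℂ} (hζ : ‖ζ‖ = 1) (hτ : ‖τ‖ = 1) (h : f ζ ≠ f τ) : Omega f p q 2 ≠ 0 := by
  intro h0
  have hζu := algebraMap_mem_unitary hζ
  have hτu := algebraMap_mem_unitary hτ
  have h1 := schSum_cfc_le_Omega_rpow hp hq zero_le_two f hζu hτu (by
    rw [schSum_complex hp]
    refine ENNReal.ofReal_le_ofReal (Real.rpow_le_rpow (norm_nonneg _) ?_ hp.le)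
    have h2 := norm_sub_le (algebraMap ℂ (ℂ →L[ℂ] ℂ) ζ) (algebraMap ℂ (ℂ →L[ℂ] ℂ) τ)
    have h3 := norm_le_one_of_mem_unitary hζu
    have h4 := norm_le_one_of_mem_unitary hτu
    linarith)
  rw [h0, ENNReal.zero_rpow_of_pos hq, schSum_complex hq, cfc_algebraMap, cfc_algebraMap,
    ← map_sub] at h1
  have h5 : 0 < ‖algebraMap ℂ (ℂ →L[ℂ] ℂ) (f ζ - f τ)‖ := by
    rw [norm_algebraMap', norm_pos_iff, sub_ne_zero]
    exact h
  exact h1.not_gt (ENNReal.ofReal_pos.2 (Real.rpow_pos_of_pos h5 q))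

lemma Omega_half_ne_zero {f : ℂ → ℂ} (hf : ContinuousOn f (Metric.sphere (0 : ℂ) 1))
    {p q : ℝ} (hp : 0 < p) (hq : 0 < q) {ζ τ : ℂ} (hζ : ‖ζ‖ = 1) (hτ : ‖τ‖ = 1)
    (h : f ζ ≠ f τ) : Omega f p q (1 / 2) ≠ 0 := by
  obtain ⟨C, -, hC⟩ := exists_Omega_le_mul_Omega_half hf hp hq
  intro h0
  have h1 : Omega f p q 1 = 0 := by
    have h1 := hC 1 one_pos
    rwa [h0, mul_zero, nonpos_iff_eq_zero] at h1
  have h2 : Omega f p q 2 = 0 := by simpa [h1] using hC 2 two_pos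
  exact Omega_two_ne_zero hp hq hζ hτ h h2

/-- The normalized modulus `Ω(δ) / δ ^ (p / q)`. -/
def OmegaRatio (f : ℂ → ℂ) (p q δ : ℝ) : ℝ≥0∞ := Omega f p q δ / ENNReal.ofReal (δ ^ (p / q))

lemma OmegaRatio_mul_le {f : ℂ → ℂ} (hf : ContinuousOn f (Metric.sphere (0 : ℂ) 1))
    {p q : ℝ} (hp : 0 < p) (hq : 0 < q) {a b : ℝ} (ha : 0 < a) (hb : 0 < b) (hab : a ≤ b) :
    OmegaRatio f p q a * ENNReal.ofReal ((1 - (a / b) ^ p) ^ (1 / q)) ≤ OmegaRatio f p q b := by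
  set n : ℕ := ⌊b ^ p / a ^ p⌋₊ with hn
  have hap : 0 < a ^ p := by positivity
  have hbp : 0 < b ^ p := by positivity
  have haq : 0 < a ^ (p / q) := by positivity
  have hbq : 0 < b ^ (p / q) := by positivity
  have h1 := Omega_mul_natCast_rpow_le hf hp hq ha.le hb.le n (by
    rw [← le_div_iff₀ hap]
    exact Nat.floor_le (by positivity))
  have h2 : 1 - (a / b) ^ p ≤ n * a ^ p / b ^ p := by
    have h3 : b ^ p / a ^ p < n + 1 := Nat.lt_floor_add_one _
    rw [div_lt_iff₀ hap] at h3
    rw [Real.div_rpow ha.le hb.le, one_sub_div hbp.ne']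
    gcongr
    linarith
  have h0 : 0 ≤ 1 - (a / b) ^ p := by
    rw [sub_nonneg]
    exact Real.rpow_le_one (by positivity) ((div_le_one hb).2 hab) hp.le
  have h4 : (1 - (a / b) ^ p) ^ (1 / q) ≤ (n : ℝ) ^ (1 / q) * a ^ (p / q) / b ^ (p / q) := by
    refine (Real.rpow_le_rpow h0 h2 (by positivity)).trans_eq ?_
    rw [Real.div_rpow (by positivity) hbp.le, Real.mul_rpow (by positivity) hap.le,
      ← Real.rpow_mul ha.le, ← Real.rpow_mul hb.le, mul_one_div]
  unfold OmegaRatio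
  calc Omega f p q a / ENNReal.ofReal (a ^ (p / q)) * ENNReal.ofReal ((1 - (a / b) ^ p) ^ (1 / q))
      ≤ Omega f p q a / ENNReal.ofReal (a ^ (p / q)) *
        ENNReal.ofReal ((n : ℝ) ^ (1 / q) * a ^ (p / q) / b ^ (p / q)) := by gcongr
    _ = Omega f p q a * (n : ℝ≥0∞) ^ (1 / q) / ENNReal.ofReal (b ^ (p / q)) := by
        rw [ENNReal.ofReal_div_of_pos hbq, ENNReal.ofReal_mul (by positivity),
          ← ENNReal.ofReal_rpow_of_nonneg (Nat.cast_nonneg n) (by positivity),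
          ENNReal.ofReal_natCast, ← mul_div_assoc, mul_comm ((n : ℝ≥0∞) ^ (1 / q)), ← mul_assoc,
          ENNReal.div_mul_cancel (ENNReal.ofReal_pos.2 haq).ne' ENNReal.ofReal_ne_top]
    _ ≤ _ := by gcongr

lemma tendsto_ratio_weight {p q : ℝ} (hp : 0 < p) (hq : 0 < q) {l : Filter ℝ} {u : ℝ → ℝ}
    (hu : Tendsto u l (nhds 0)) :
    Tendsto (fun x => ENNReal.ofReal ((1 - u x ^ p) ^ (1 / q))) l (nhds 1) := by
  have h1 : Tendsto (fun x => (1 - u x ^ p) ^ (1 / q)) l (nhds ((1 - (0 : ℝ) ^ p) ^ (1 / q))) :=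
    ((tendsto_const_nhds.sub (hu.rpow_const (Or.inr hp.le))).rpow_const (Or.inr (by positivity)))
  rw [Real.zero_rpow hp.ne', sub_zero, Real.one_rpow] at h1
  simpa using ENNReal.tendsto_ofReal h1

lemma tendsto_OmegaRatio_atTop {f : ℂ → ℂ} (hf : ContinuousOn f (Metric.sphere (0 : ℂ) 1))
    {p q : ℝ} (hp : 0 < p) (hq : 0 < q) :
    Tendsto (OmegaRatio f p q) atTop (nhds (⨆ δ : Set.Ioi (0 : ℝ), OmegaRatio f p q δ)) := by
  refine tendsto_order.2 ⟨fun c hc => ?_, fun c hc => ?_⟩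
  · obtain ⟨⟨a, ha⟩, hca⟩ := lt_iSup_iff.1 hc
    have ha : 0 < a := ha
    have h1 := ENNReal.Tendsto.const_mul (a := OmegaRatio f p q a)
      (tendsto_ratio_weight hp hq (tendsto_const_nhds.div_atTop tendsto_id : Tendsto
        (fun b : ℝ => a / b) atTop (nhds 0))) (Or.inl one_ne_zero)
    rw [mul_one] at h1
    filter_upwards [h1.eventually (lt_mem_nhds hca), eventually_ge_atTop a] with b hb hab
    exact hb.trans_le (OmegaRatio_mul_le hf hp hq ha (ha.trans_le hab) hab)
  · filter_upwards [eventually_gt_atTop 0] with b hb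
    exact (le_iSup (fun δ : Set.Ioi (0 : ℝ) => OmegaRatio f p q δ) ⟨b, hb⟩).trans_lt hc

lemma tendsto_OmegaRatio_nhdsGT_zero {f : ℂ → ℂ}
    (hf : ContinuousOn f (Metric.sphere (0 : ℂ) 1)) {p q : ℝ} (hp : 0 < p) (hq : 0 < q) :
    Tendsto (OmegaRatio f p q) (nhdsWithin 0 (Set.Ioi 0))
      (nhds (⨅ δ : Set.Ioi (0 : ℝ), OmegaRatio f p q δ)) := by
  refine tendsto_order.2 ⟨fun c hc => ?_, fun c hc => ?_⟩
  · filter_upwards [self_mem_nhdsWithin] with a ha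
    exact hc.trans_le (iInf_le (fun δ : Set.Ioi (0 : ℝ) => OmegaRatio f p q δ) ⟨a, ha⟩)
  · obtain ⟨⟨b, hb⟩, hbc⟩ := iInf_lt_iff.1 hc
    have hb : 0 < b := hb
    have hu : Tendsto (fun a : ℝ => a / b) (nhdsWithin 0 (Set.Ioi 0)) (nhds 0) := by
      have : Tendsto (fun a : ℝ => a / b) (nhds 0) (nhds (0 / b)) := tendsto_id.div_const b
      rw [zero_div] at this
      exact this.mono_left nhdsWithin_le_nhds
    have hw := tendsto_ratio_weight hp hq hu
    have h1 := ENNReal.Tendsto.const_div (a := OmegaRatio f p q b) hw (Or.inl ENNReal.one_ne_top)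
    rw [div_one] at h1
    filter_upwards [h1.eventually (gt_mem_nhds hbc), hw.eventually_ne one_ne_zero,
      self_mem_nhdsWithin, mem_nhdsWithin_of_mem_nhds (Iio_mem_nhds hb)] with a h2 h3 ha hab
    refine lt_of_le_of_lt ?_ h2
    rw [ENNReal.le_div_iff_mul_le (Or.inl h3) (Or.inl ENNReal.ofReal_ne_top)]
    exact OmegaRatio_mul_le hf hp hq ha hb (le_of_lt hab)

lemma OmegaRatio_mul_half_le {f : ℂ → ℂ} (hf : ContinuousOn f (Metric.sphere (0 : ℂ) 1))
    {p q : ℝ} (hp : 0 < p) (hq : 0 < q) {a b : ℝ} (ha : 0 < a) (hab : 2 * a ≤ b) :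
    OmegaRatio f p q a * ENNReal.ofReal ((1 - (1 / 2) ^ p) ^ (1 / q)) ≤ OmegaRatio f p q b := by
  have hb : 0 < b := by linarith
  refine le_trans ?_ (OmegaRatio_mul_le hf hp hq ha hb (by linarith))
  have h1 : a / b ≤ 1 / 2 := by rw [div_le_div_iff₀ hb two_pos]; linarith
  have h2 : (0 : ℝ) ≤ 1 - (1 / 2) ^ p :=
    sub_nonneg.2 (Real.rpow_le_one (by norm_num) (by norm_num) hp.le)
  gcongr

end Limits

open Filter in
theorem stmt16 (p q : ℝ) (hp : 0 < p) (hq : 0 < q) (f : ℂ → ℂ)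
    (hf : ContinuousOn f (Metric.sphere (0 : ℂ) 1))
    (hyp : ∀ (H : Type) [NormedAddCommGroup H] [InnerProductSpace ℂ H] [CompleteSpace H]
      [TopologicalSpace.SeparableSpace H],
      ∀ U V : H →L[ℂ] H, U ∈ unitary (H →L[ℂ] H) → V ∈ unitary (H →L[ℂ] H) →
        MemSchatten p (U - V) → MemSchatten q (cfc f U - cfc f V)) :
    (∀ δ : ℝ, 0 < δ → Omega f p q δ < ⊤) ∧
    Tendsto (fun δ : ℝ => Omega f p q δ / ENNReal.ofReal (δ ^ (p / q)))
      (nhdsWithin 0 (Set.Ioi 0))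
      (nhds (⨅ δ : Set.Ioi (0 : ℝ), Omega f p q δ / ENNReal.ofReal ((δ : ℝ) ^ (p / q)))) ∧
    Tendsto (fun δ : ℝ => Omega f p q δ / ENNReal.ofReal (δ ^ (p / q))) atTop
      (nhds (⨆ δ : Set.Ioi (0 : ℝ), Omega f p q δ / ENNReal.ofReal ((δ : ℝ) ^ (p / q)))) ∧
    (⨅ δ : Set.Ioi (0 : ℝ), Omega f p q δ / ENNReal.ofReal ((δ : ℝ) ^ (p / q))) ≤
      (⨆ δ : Set.Ioi (0 : ℝ), Omega f p q δ / ENNReal.ofReal ((δ : ℝ) ^ (p / q))) ∧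
    ((∃ ζ τ : ℂ, ‖ζ‖ = 1 ∧ ‖τ‖ = 1 ∧ f ζ ≠ f τ) →
      ∃ c₁ c₂ : ℝ, 0 < c₁ ∧ 0 < c₂ ∧
        (∀ δ : ℝ, 0 < δ → δ ≤ 1 → Omega f p q δ ≤ ENNReal.ofReal (c₁ * δ ^ (p / q))) ∧
        (∀ δ : ℝ, 1 ≤ δ → ENNReal.ofReal (c₂ * δ ^ (p / q)) ≤ Omega f p q δ)) := by
  have hfin : ∀ δ : ℝ, 0 < δ → Omega f p q δ < ⊤ := fun δ hδ => Omega_lt_top hf hp hq hyp hδ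
  refine ⟨hfin, tendsto_OmegaRatio_nhdsGT_zero hf hp hq, tendsto_OmegaRatio_atTop hf hp hq,
    iInf_le_iSup, ?_⟩
  rintro ⟨ζ, τ, hζ, hτ, hne⟩
  have hpos : ∀ δ : ℝ, 0 < δ → ENNReal.ofReal (δ ^ (p / q)) ≠ 0 := fun δ hδ =>
    (ENNReal.ofReal_pos.2 (Real.rpow_pos_of_pos hδ _)).ne'
  have hratio : ∀ δ : ℝ, 0 < δ → OmegaRatio f p q δ ≠ ⊤ := fun δ hδ =>
    ENNReal.div_ne_top (hfin δ hδ).ne (hpos δ hδ)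
  have hw : 0 < ENNReal.ofReal ((1 - (1 / 2) ^ p) ^ (1 / q)) := by
    refine ENNReal.ofReal_pos.2 (Real.rpow_pos_of_pos (sub_pos.2 ?_) _)
    exact Real.rpow_lt_one (by norm_num) (by norm_num) hp
  set w := ENNReal.ofReal ((1 - (1 / 2) ^ p) ^ (1 / q)) with hwdef
  have hwt : w ≠ ⊤ := ENNReal.ofReal_ne_top
  have hc₁ : OmegaRatio f p q 2 / w ≠ ⊤ := ENNReal.div_ne_top (hratio 2 two_pos) hw.ne'
  have hc₂ : OmegaRatio f p q (1 / 2) * w ≠ ⊤ :=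
    ENNReal.mul_ne_top (hratio _ (by norm_num)) hwt
  have hc₂' : OmegaRatio f p q (1 / 2) * w ≠ 0 :=
    mul_ne_zero (ENNReal.div_ne_zero.2 ⟨Omega_half_ne_zero hf hp hq hζ hτ hne,
      ENNReal.ofReal_ne_top⟩) hw.ne'
  refine ⟨(OmegaRatio f p q 2 / w).toReal + 1, (OmegaRatio f p q (1 / 2) * w).toReal,
    by positivity, ENNReal.toReal_pos hc₂' hc₂, fun δ h0 h1 => ?_, fun δ h1 => ?_⟩
  · have h2 := OmegaRatio_mul_half_le (b := 2) hf hp hq h0 (by linarith)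
    rw [← ENNReal.le_div_iff_mul_le (Or.inl hw.ne') (Or.inl hwt), OmegaRatio,
      ENNReal.div_le_iff (hpos δ h0) ENNReal.ofReal_ne_top] at h2
    refine h2.trans ?_
    rw [ENNReal.ofReal_mul (by positivity)]
    gcongr
    rw [← ENNReal.ofReal_toReal hc₁, ENNReal.toReal_ofReal ENNReal.toReal_nonneg]
    exact ENNReal.ofReal_le_ofReal (by linarith)
  · have h0 : 0 < δ := by linarith
    have h2 := OmegaRatio_mul_half_le (a := 1 / 2) (b := δ) hf hp hq (by norm_num) (by linarith)
    rw [OmegaRatio.eq_def f p q δ, ENNReal.le_div_iff_mul_le (Or.inl (hpos δ h0))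
      (Or.inl ENNReal.ofReal_ne_top)] at h2
    rwa [ENNReal.ofReal_mul ENNReal.toReal_nonneg, ENNReal.ofReal_toReal hc₂]
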